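/- arXiv:2103.07848 — 2 statements merged into one kernel-verified Lean document; each statement's English description precedes it below -/
import Mathlib

section
/- Let β ∈ (0, d], let x ∈ Γ be an Ahlfors point with exponent β, let δ ≥ 0 with δ ≠ 2 − β, and let U be a bounded open subset of ℝ^d containing x. If for some r > 0 and a > 0 the inequality ‖d_Γ^{δ/2−1}ψ‖_2 ≤ a‖d_Γ^{δ/2}|∇ψ|‖_2 holds for all ψ ∈ C_c^1(Γ_r ∩ U), then a ≥ 2/|β + δ − 2|. In particular the local Hardy constant a_δ(x) = inf{a_δ(Γ∩V) : V ⊆ U bounded open, x ∈ V} satisfies a_δ(x) ≥ 2/|β + δ − 2| (with β = d − d_H for a boundary of Hausdorff dimension d_H). -/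
open MeasureTheory Metric Set ENNReal RealInnerProductSpace

noncomputable section

/-- The Euclidean distance from `x` to the boundary `Γ = ∂Ω` of `Ω`. -/
def distB {d : ℕ} (Ω : Set (EuclideanSpace ℝ (Fin d))) (x : EuclideanSpace ℝ (Fin d)) : ℝ :=
  Metric.infDist x (frontier Ω)

/-- The boundary layer `Γ_r = {x ∈ Ω : d_Γ(x) < r}`. -/
def bdryLayer {d : ℕ} (Ω : Set (EuclideanSpace ℝ (Fin d))) (r : ℝ) :
    Set (EuclideanSpace ℝ (Fin d)) :=
  {x | x ∈ Ω ∧ distB Ω x < r}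

/-- `C_c^1` real functions with compact support contained in `U`. -/
def IsCc1 {d : ℕ} (U : Set (EuclideanSpace ℝ (Fin d)))
    (ψ : EuclideanSpace ℝ (Fin d) → ℝ) : Prop :=
  ContDiff ℝ 1 ψ ∧ HasCompactSupport ψ ∧ tsupport ψ ⊆ U

/-- The `L²` norm with respect to Lebesgue measure. -/
def L2N {d : ℕ} (f : EuclideanSpace ℝ (Fin d) → ℝ) : ℝ≥0∞ :=
  eLpNorm f 2 volume

/-- The weighted norm `‖d_Γ^p ψ‖₂`. -/
def wNorm {d : ℕ} (Ω : Set (EuclideanSpace ℝ (Fin d))) (p : ℝ)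
    (ψ : EuclideanSpace ℝ (Fin d) → ℝ) : ℝ≥0∞ :=
  L2N (fun x => distB Ω x ^ p * ψ x)

/-- The weighted gradient norm `‖d_Γ^p |∇ψ|‖₂`. -/
def wGradNorm {d : ℕ} (Ω : Set (EuclideanSpace ℝ (Fin d))) (p : ℝ)
    (ψ : EuclideanSpace ℝ (Fin d) → ℝ) : ℝ≥0∞ :=
  L2N (fun x => distB Ω x ^ p * ‖fderiv ℝ ψ x‖)

/-- The (boundary) Hardy inequality `‖d_Γ^{δ/2-1}ψ‖₂ ≤ a ‖d_Γ^{δ/2}|∇ψ|‖₂`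
with constant `a` for all test functions `ψ ∈ C_c^1(S)`. -/
def BHardy {d : ℕ} (Ω : Set (EuclideanSpace ℝ (Fin d))) (δ : ℝ)
    (S : Set (EuclideanSpace ℝ (Fin d))) (a : ℝ) : Prop :=
  ∀ ψ, IsCc1 S ψ → wNorm Ω (δ/2 - 1) ψ ≤ ENNReal.ofReal a * wGradNorm Ω (δ/2) ψ

/-- The weak Hardy inequality `‖d_Γ^{δ/2-1}ψ‖₂ ≤ b ‖d_Γ^{δ/2}|∇ψ|‖₂ + c ‖ψ‖₂`
with constants `b, c` for all test functions `ψ ∈ C_c^1(S)`. -/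
def WHardy {d : ℕ} (Ω : Set (EuclideanSpace ℝ (Fin d))) (δ : ℝ)
    (S : Set (EuclideanSpace ℝ (Fin d))) (b c : ℝ) : Prop :=
  ∀ ψ, IsCc1 S ψ →
    wNorm Ω (δ/2 - 1) ψ ≤ ENNReal.ofReal b * wGradNorm Ω (δ/2) ψ + ENNReal.ofReal c * L2N ψ

/-- The optimal Hardy constant for test functions supported in `S`
(the infimum of the `a > 0` for which the Hardy inequality holds on `S`;
`∞` if there is no such constant). -/
def hardyConstS {d : ℕ} (Ω : Set (EuclideanSpace ℝ (Fin d))) (δ : ℝ)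
    (S : Set (EuclideanSpace ℝ (Fin d))) : ℝ≥0∞ :=
  sInf {t | ∃ a : ℝ, 0 < a ∧ t = ENNReal.ofReal a ∧ BHardy Ω δ S a}

/-- The boundary Hardy constant `a_δ(Γ) = inf_{r>0} a_δ(Γ_r)`. -/
def hardyConst {d : ℕ} (Ω : Set (EuclideanSpace ℝ (Fin d))) (δ : ℝ) : ℝ≥0∞ :=
  ⨅ (r : ℝ) (_ : 0 < r), hardyConstS Ω δ (bdryLayer Ω r)

/-- The local boundary Hardy constant `a_δ(Γ ∩ U) = inf_{r>0} a_δ(Γ_r ∩ U)`. -/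
def hardyConstOn {d : ℕ} (Ω : Set (EuclideanSpace ℝ (Fin d))) (δ : ℝ)
    (U : Set (EuclideanSpace ℝ (Fin d))) : ℝ≥0∞ :=
  ⨅ (r : ℝ) (_ : 0 < r), hardyConstS Ω δ (bdryLayer Ω r ∩ U)

/-- The weak Hardy constant `b_δ(Ω)`: the infimum of the `b > 0` for which there
is a `c > 0` such that the weak Hardy inequality holds on `Ω`. -/
def weakConstDomain {d : ℕ} (Ω : Set (EuclideanSpace ℝ (Fin d))) (δ : ℝ) : ℝ≥0∞ :=
  sInf {t | ∃ b c : ℝ, 0 < b ∧ 0 < c ∧ t = ENNReal.ofReal b ∧ WHardy Ω δ Ω b c}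

/-- The weak Hardy constant `b_δ(Γ)`: the infimum of the `b > 0` for which there
are `r > 0` and `c > 0` such that the weak Hardy inequality holds on `Γ_r`. -/
def weakConstBdry {d : ℕ} (Ω : Set (EuclideanSpace ℝ (Fin d))) (δ : ℝ) : ℝ≥0∞ :=
  sInf {t | ∃ b c r : ℝ, 0 < b ∧ 0 < c ∧ 0 < r ∧ t = ENNReal.ofReal b ∧
    WHardy Ω δ (bdryLayer Ω r) b c}

/-- The weak Hardy constant `b_δ(Γ ∩ U)`. -/
def weakConstOn {d : ℕ} (Ω : Set (EuclideanSpace ℝ (Fin d))) (δ : ℝ)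
    (U : Set (EuclideanSpace ℝ (Fin d))) : ℝ≥0∞ :=
  sInf {t | ∃ b c r : ℝ, 0 < b ∧ 0 < c ∧ 0 < r ∧ t = ENNReal.ofReal b ∧
    WHardy Ω δ (bdryLayer Ω r ∩ U) b c}

/-- A domain: a nonempty open connected proper subset of `ℝ^d`. -/
def IsDomainSet {d : ℕ} (Ω : Set (EuclideanSpace ℝ (Fin d))) : Prop :=
  IsOpen Ω ∧ IsConnected Ω ∧ Ω ≠ Set.univ

/-- The (open) `r`-enlargement `A_r = {y ∈ Ω̄ : dist(y,A) < r}` of a set `A` within `Ω̄`. -/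
def enlarge {d : ℕ} (Ω : Set (EuclideanSpace ℝ (Fin d)))
    (A : Set (EuclideanSpace ℝ (Fin d))) (r : ℝ) : Set (EuclideanSpace ℝ (Fin d)) :=
  {y | y ∈ closure Ω ∧ Metric.infDist y A < r}

/-- `x ∈ Γ` is an Ahlfors point with exponent `β`: for all sufficiently small `s > 0`,
setting `A = Γ ∩ B(x;s)`, there are `κ, κ' > 0` with `κ' r^β ≤ |A_r| ≤ κ r^β` for all
sufficiently small `r > 0`. -/
def AhlforsPoint {d : ℕ} (Ω : Set (EuclideanSpace ℝ (Fin d))) (β : ℝ)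
    (x : EuclideanSpace ℝ (Fin d)) : Prop :=
  x ∈ frontier Ω ∧
  ∃ s₀ > (0:ℝ), ∀ s ∈ Set.Ioo (0:ℝ) s₀,
    ∃ κ κ' : ℝ, 0 < κ ∧ 0 < κ' ∧ ∃ r₀ > (0:ℝ), ∀ r ∈ Set.Ioo (0:ℝ) r₀,
      ENNReal.ofReal (κ' * r ^ β)
          ≤ volume (enlarge Ω (frontier Ω ∩ Metric.ball x s) r) ∧
      volume (enlarge Ω (frontier Ω ∩ Metric.ball x s) r)
          ≤ ENNReal.ofReal (κ * r ^ β)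

/-- A `1`-Lipschitz function on a Euclidean space is uniformly approximated by `C^1` functions
whose gradient has norm at most `1`. -/
theorem LipschitzWith.exists_contDiff_approx {d : ℕ} {g : EuclideanSpace ℝ (Fin d) → ℝ}
    (hg : LipschitzWith 1 g) {ε : ℝ} (hε : 0 < ε) :
    ∃ D : EuclideanSpace ℝ (Fin d) → ℝ, ContDiff ℝ 1 D ∧ (∀ y, |D y - g y| ≤ ε) ∧
      ∀ y, ‖fderiv ℝ D y‖ ≤ 1 := by
  let φ : ContDiffBump (0 : EuclideanSpace ℝ (Fin d)) := ⟨ε / 2, ε, half_pos hε, half_lt_self hε⟩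
  let D := convolution (φ.normed volume) g (ContinuousLinearMap.lsmul ℝ ℝ) volume
  have hφg : ∀ y, Integrable (fun t => φ.normed volume t * g (y - t)) := fun y =>
    (φ.continuous_normed.mul (hg.continuous.comp (continuous_const.sub continuous_id')))
      |>.integrable_of_hasCompactSupport φ.hasCompactSupport_normed.mul_right
  have hlip : LipschitzWith 1 D := by
    refine LipschitzWith.of_dist_le_mul fun y z => ?_
    have hD : ∀ y, D y = ∫ t, φ.normed volume t * g (y - t) := fun y => rfl
    rw [hD, hD, dist_eq_norm, ← integral_sub (hφg y) (hφg z)]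
    calc ‖∫ t, (φ.normed volume t * g (y - t) - φ.normed volume t * g (z - t))‖
        ≤ ∫ t, φ.normed volume t * dist y z := by
          refine norm_integral_le_of_norm_le (φ.integrable_normed.mul_const _)
            (Filter.Eventually.of_forall fun t => ?_)
          rw [← mul_sub, norm_mul, Real.norm_of_nonneg (φ.nonneg_normed t)]
          refine mul_le_mul_of_nonneg_left ?_ (φ.nonneg_normed t)
          have := hg.dist_le_mul (y - t) (z - t)
          simpa [dist_eq_norm] using this
      _ = ((1 : NNReal) : ℝ) * dist y z := by
          rw [integral_mul_const, φ.integral_normed]; simp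
  refine ⟨D, φ.hasCompactSupport_normed.contDiff_convolution_left _ φ.contDiff_normed
    hg.continuous.locallyIntegrable, fun y => ?_, fun y => ?_⟩
  · refine φ.dist_normed_convolution_le hg.continuous.aestronglyMeasurable fun z hz => ?_
    have := hg.dist_le_mul z y
    simp only [NNReal.coe_one, one_mul] at this
    exact this.trans (mem_ball.1 hz).le
  · simpa using norm_fderiv_le_of_lipschitz ℝ hlip

/-- A truncation of the power `t ^ (-σ)` near the origin, with derivative controlled by
`t ^ (-σ - 1)` uniformly in the truncation scale. -/
theorem exists_truncated_rpow (σ : ℝ) :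
    ∃ C : ℝ, 0 ≤ C ∧ ∀ ε : ℝ, 0 < ε → ∃ f : ℝ → ℝ, ContDiff ℝ 1 f ∧
      (∀ t ≤ ε, f t = 0) ∧ (∀ t < ε, deriv f t = 0) ∧
      (∀ t, ε ≤ t → |f t| ≤ t ^ (-σ)) ∧ (∀ t, 2 * ε < t → f t = t ^ (-σ)) ∧
      (∀ t, 2 * ε < t → |deriv f t| ≤ |σ| * t ^ (-σ - 1)) ∧
      (∀ t, ε ≤ t → |deriv f t| ≤ C * t ^ (-σ - 1)) := by
  obtain ⟨C, hC⟩ := (isCompact_Icc (a := (0 : ℝ)) (b := 1)).exists_bound_of_continuousOn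
    ((Real.smoothTransition.contDiff (n := 1)).continuous_deriv le_rfl).continuousOn
  have hC0 : 0 ≤ C := (norm_nonneg _).trans (hC 0 (by simp))
  refine ⟨|σ| + 2 * C, by positivity, fun ε hε => ?_⟩
  let f : ℝ → ℝ := fun t => t ^ (-σ) * Real.smoothTransition (t / ε - 1)
  have hzero : ∀ t ≤ ε, f t = 0 := fun t ht => by
    have : t / ε - 1 ≤ 0 := by rw [sub_nonpos, div_le_one hε]; exact ht
    simp [f, Real.smoothTransition.zero_of_nonpos this]
  have heq : ∀ t, 2 * ε < t → f t = t ^ (-σ) := fun t ht => by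
    have : 1 ≤ t / ε - 1 := by rw [le_sub_iff_add_le, le_div_iff₀ hε]; linarith
    simp [f, Real.smoothTransition.one_of_one_le this]
  have hlarge : ∀ t, 2 * ε < t → |deriv f t| ≤ |σ| * t ^ (-σ - 1) := fun t ht => by
    have h0 : 0 < t := by linarith
    have he : f =ᶠ[nhds t] fun t => t ^ (-σ) := by
      filter_upwards [lt_mem_nhds ht] with u hu using heq u hu
    rw [he.deriv_eq, (Real.hasDerivAt_rpow_const (Or.inl h0.ne')).deriv, abs_mul, abs_neg,
      abs_of_nonneg (Real.rpow_nonneg h0.le _)]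
  have hS1 : ∀ s, |Real.smoothTransition s| ≤ 1 := fun s => by
    rw [abs_of_nonneg (Real.smoothTransition.nonneg s)]
    exact Real.smoothTransition.le_one s
  refine ⟨f, ?_, hzero, fun t ht => ?_, fun t ht => ?_, heq, hlarge, fun t ht => ?_⟩
  · rw [contDiff_iff_contDiffAt]
    intro t
    rcases lt_or_ge t ε with ht | ht
    · have he : f =ᶠ[nhds t] fun _ => 0 := by
        filter_upwards [gt_mem_nhds ht] with u hu using hzero u hu.le
      exact contDiffAt_const.congr_of_eventuallyEq he
    · refine (Real.contDiffAt_rpow_const_of_ne (by linarith)).mul ?_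
      exact (Real.smoothTransition.contDiff.comp
        ((contDiff_id.div_const ε).sub contDiff_const)).contDiffAt
  · have he : f =ᶠ[nhds t] fun _ => 0 := by
      filter_upwards [gt_mem_nhds ht] with u hu using hzero u hu.le
    rw [he.deriv_eq, deriv_const]
  · have h0 : 0 < t := by linarith
    rw [abs_mul, abs_of_nonneg (Real.rpow_nonneg h0.le _)]
    exact mul_le_of_le_one_right (Real.rpow_nonneg h0.le _) (hS1 _)
  · have h0 : 0 < t := by linarith
    have hp : 0 ≤ t ^ (-σ - 1) := Real.rpow_nonneg h0.le _
    rcases lt_or_ge (2 * ε) t with h2 | h2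
    · refine (hlarge t h2).trans (mul_le_mul_of_nonneg_right ?_ hp)
      linarith
    · have hd := (Real.hasDerivAt_rpow_const (p := -σ) (Or.inl h0.ne')).mul
        (((Real.smoothTransition.contDiff (n := 1)).differentiable one_ne_zero
          (t / ε - 1)).hasDerivAt.comp t (((hasDerivAt_id t).div_const ε).sub_const 1))
      have hd' : deriv f t = _ := hd.deriv
      have hmem : t / ε - 1 ∈ Icc (0 : ℝ) 1 := by
        constructor
        · rw [sub_nonneg, le_div_iff₀ hε]; linarith
        · rw [sub_le_iff_le_add, div_le_iff₀ hε]; linarith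
      have hCt := hC _ hmem
      rw [Real.norm_eq_abs] at hCt
      have hsplit : t ^ (-σ) = t ^ (-σ - 1) * t := by
        rw [Real.rpow_sub_one h0.ne']; field_simp
      have hte : t * (1 / ε) ≤ 2 := by
        rw [mul_one_div, div_le_iff₀ hε]; linarith
      rw [hd']
      simp only [Function.comp_apply, id]
      rw [hsplit]
      refine (abs_add_le _ _).trans ?_
      have e1 : |-σ * t ^ (-σ - 1) * Real.smoothTransition (t / ε - 1)| ≤ |σ| * t ^ (-σ - 1) := by
        rw [abs_mul, abs_mul, abs_neg, abs_of_nonneg hp]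
        exact mul_le_of_le_one_right (by positivity) (hS1 _)
      have e2 : |t ^ (-σ - 1) * t * (deriv Real.smoothTransition (t / ε - 1) * (1 / ε))|
          ≤ 2 * C * t ^ (-σ - 1) := by
        rw [show t ^ (-σ - 1) * t * (deriv Real.smoothTransition (t / ε - 1) * (1 / ε)) =
          t ^ (-σ - 1) * (t * (1 / ε)) * deriv Real.smoothTransition (t / ε - 1) by ring,
          abs_mul, abs_of_nonneg (by positivity)]
        calc t ^ (-σ - 1) * (t * (1 / ε)) * |deriv Real.smoothTransition (t / ε - 1)|
            ≤ t ^ (-σ - 1) * 2 * C := by gcongr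
          _ = _ := by ring
      linarith

theorem eLpNorm_two_sq_eq_lintegral {X : Type*} [MeasurableSpace X] (μ : Measure X) (f : X → ℝ) :
    eLpNorm f 2 μ ^ 2 = ∫⁻ y, ‖f y‖ₑ ^ 2 ∂μ := by
  have h := eLpNorm_nnreal_pow_eq_lintegral (μ := μ) (f := f) (p := 2) two_ne_zero
  simpa using h

/-- If the measure of the sublevel sets `{g < t}` is at most of order `t ^ β`, then
`g ^ (1 - β / 2)` is square integrable. -/
theorem eLpNorm_indicator_rpow_ne_top {X : Type*} [MeasurableSpace X] {μ : Measure X} {g : X → ℝ}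
    (hg : Measurable g) {E : Set X} (hE : MeasurableSet E) (hμE : μ E ≠ ⊤) {ρ t₀ κ β : ℝ}
    (hpos : ∀ y ∈ E, 0 < g y) (hle : ∀ y ∈ E, g y ≤ ρ) (hβ : 0 < β) (ht₀ : 0 < t₀)
    (h : ∀ t ∈ Ioo 0 t₀, μ (E ∩ {y | g y < t}) ≤ ENNReal.ofReal (κ * t ^ β)) :
    eLpNorm (E.indicator fun y => g y ^ (1 - β / 2)) 2 μ ≠ ⊤ := by
  let τ : ℕ → ℝ := fun n => (1 / 2) ^ n * (t₀ / 2)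
  let S : ℕ → Set X := fun n => E ∩ {y | g y < τ n}
  have hτ : ∀ n, 0 < τ n := fun n => by positivity
  have hτt : ∀ n, τ n < t₀ := fun n => by
    have : ((1 : ℝ) / 2) ^ n ≤ 1 := pow_le_one₀ (by norm_num) (by norm_num)
    have : (1 / 2) ^ n * (t₀ / 2) ≤ 1 * (t₀ / 2) := by gcongr
    simp only [τ]; linarith
  have hS : ∀ n, MeasurableSet (S n) := fun n => hE.inter (measurableSet_lt hg measurable_const)
  let b : ℕ → ℝ := fun n => τ n ^ 2 * (τ n / 4) ^ (-β)
  have hb : ∀ n, 0 ≤ b n := fun n => by have := hτ n; positivity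
  have key : ∀ y, ‖E.indicator (fun y => g y ^ (1 - β / 2)) y‖ₑ ^ 2 ≤
      E.indicator (fun _ => ENNReal.ofReal (ρ ^ 2 * (t₀ / 4) ^ (-β))) y +
        ∑' n, (S n).indicator (fun _ => ENNReal.ofReal (b n)) y := by
    intro y
    by_cases hy : y ∈ E
    · have h0 := hpos y hy
      have hsq : ‖g y ^ (1 - β / 2)‖ₑ ^ 2 = ENNReal.ofReal (g y ^ 2 * g y ^ (-β)) := by
        rw [Real.enorm_of_nonneg (by positivity), ← ENNReal.ofReal_pow (by positivity),
          ← Real.rpow_natCast, ← Real.rpow_mul h0.le, ← Real.rpow_natCast (g y),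
          ← Real.rpow_add h0]
        congr 2; push_cast; ring
      rw [indicator_of_mem hy, indicator_of_mem hy, hsq]
      rcases le_or_gt (g y) (t₀ / 4) with hs | hs
      · obtain ⟨n, hn1, hn2⟩ := exists_nat_pow_near_of_lt_one (x := g y / (t₀ / 4))
          (y := (1 / 2 : ℝ)) (by positivity) ((div_le_one (by positivity)).2 hs)
          (by norm_num) (by norm_num)
        rw [lt_div_iff₀ (by positivity)] at hn1
        rw [div_le_iff₀ (by positivity)] at hn2
        have hp : (0 : ℝ) < (1 / 2) ^ n := by positivity
        have h1 : g y < τ n := by simp only [τ]; nlinarith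
        have h2 : τ n / 4 ≤ g y := by
          simp only [τ]; rw [pow_succ] at hn1; linarith
        refine le_add_left (le_trans ?_ (ENNReal.le_tsum n))
        rw [indicator_of_mem (show y ∈ S n from ⟨hy, h1⟩)]
        refine ENNReal.ofReal_le_ofReal ?_
        have := hτ n
        exact mul_le_mul (pow_le_pow_left₀ h0.le h1.le 2)
          (Real.rpow_le_rpow_of_nonpos (by positivity) h2 (by linarith)) (by positivity)
          (by positivity)
      · refine le_add_right (ENNReal.ofReal_le_ofReal ?_)
        exact mul_le_mul (pow_le_pow_left₀ h0.le (hle y hy) 2)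
          (Real.rpow_le_rpow_of_nonpos (by positivity) hs.le (by linarith)) (by positivity)
          (by positivity)
    · simp [hy]
  have hfin : eLpNorm (E.indicator fun y => g y ^ (1 - β / 2)) 2 μ ^ 2 < ⊤ := by
    rw [eLpNorm_two_sq_eq_lintegral]
    refine (lintegral_mono key).trans_lt ?_
    rw [lintegral_add_left (measurable_const.indicator hE),
      lintegral_tsum fun n => (measurable_const.indicator (hS n)).aemeasurable]
    simp only [lintegral_indicator_const hE, lintegral_indicator_const (hS _)]
    refine ENNReal.add_lt_top.2 ⟨ENNReal.mul_lt_top ENNReal.ofReal_lt_top hμE.lt_top, ?_⟩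
    have hterm : ∀ n, ENNReal.ofReal (b n) * μ (S n) ≤
        ENNReal.ofReal (4 ^ β * κ * (t₀ / 2) ^ 2 * (1 / 4) ^ n) := fun n => by
      refine (mul_le_mul_right (h (τ n) ⟨hτ n, hτt n⟩) _).trans ?_
      rw [← ENNReal.ofReal_mul (hb n)]
      refine ENNReal.ofReal_le_ofReal (le_of_eq ?_)
      have h1 : τ n ^ (-β) * τ n ^ β = 1 := by
        rw [← Real.rpow_add (hτ n)]; simp
      have h2 : ((4 : ℝ)) ^ (-β) * 4 ^ β = 1 := by
        rw [← Real.rpow_add (by norm_num)]; simp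
      have h3 : (τ n / 4) ^ (-β) = τ n ^ (-β) * 4 ^ β := by
        rw [Real.div_rpow (hτ n).le (by norm_num), div_eq_iff (by positivity), mul_assoc,
          mul_comm ((4 : ℝ) ^ β), h2, mul_one]
      have h4 : τ n ^ 2 = (t₀ / 2) ^ 2 * (1 / 4) ^ n := by
        simp only [τ]
        rw [mul_pow, ← pow_mul, mul_comm n 2, pow_mul]; norm_num [mul_comm]
      simp only [b]
      rw [h3, h4]
      linear_combination (4 ^ β * κ * (t₀ / 2) ^ 2 * (1 / 4) ^ n) * h1
    refine (ENNReal.tsum_le_tsum hterm).trans_lt ?_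
    exact ((summable_geometric_of_lt_one (by norm_num) (by norm_num)).mul_left _).tsum_ofReal_lt_top
  intro htop
  simp [htop] at hfin

/-- A lower bound for the `L^2` norm by contributions of disjoint sets. -/
theorem natCast_mul_le_eLpNorm_two_sq {X : Type*} [MeasurableSpace X] {μ : Measure X} {f : X → ℝ}
    {A : ℕ → Set X} (hA : ∀ k, MeasurableSet (A k)) (hd : Pairwise fun i j => Disjoint (A i) (A j))
    {b : ℕ → ℝ≥0∞} {c : ℝ≥0∞} {n : ℕ} (hb : ∀ k < n, ∀ y ∈ A k, b k ≤ ‖f y‖ₑ)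
    (hc : ∀ k < n, c ≤ b k ^ 2 * μ (A k)) :
    n * c ≤ eLpNorm f 2 μ ^ 2 := by
  calc (n : ℝ≥0∞) * c = ∑ _k ∈ Finset.range n, c := by simp
    _ ≤ ∑ k ∈ Finset.range n, ∫⁻ y in A k, ‖f y‖ₑ ^ 2 ∂μ := by
        refine Finset.sum_le_sum fun k hk => (hc k (Finset.mem_range.1 hk)).trans ?_
        rw [← setLIntegral_const]
        exact setLIntegral_mono' (hA k) fun y hy =>
          pow_le_pow_left₀ zero_le (hb k (Finset.mem_range.1 hk) y hy) 2
    _ = ∫⁻ y in ⋃ k ∈ Finset.range n, A k, ‖f y‖ₑ ^ 2 ∂μ :=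
        (lintegral_biUnion_finset (fun i _ j _ hij => hd hij) (fun k _ => hA k) _).symm
    _ ≤ eLpNorm f 2 μ ^ 2 := by
        rw [eLpNorm_two_sq_eq_lintegral]
        exact setLIntegral_le_lintegral _ _

theorem continuous_distB {d : ℕ} (Ω : Set (EuclideanSpace ℝ (Fin d))) : Continuous (distB Ω) :=
  continuous_infDist_pt _

theorem distB_pos {d : ℕ} {Ω : Set (EuclideanSpace ℝ (Fin d))} (hΩ : IsOpen Ω)
    (hne : (frontier Ω).Nonempty) {y : EuclideanSpace ℝ (Fin d)} (hy : y ∈ Ω) : 0 < distB Ω y := by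
  refine (isClosed_frontier.notMem_iff_infDist_pos hne).1 fun h => ?_
  rw [hΩ.frontier_eq] at h
  exact h.2 hy

theorem mem_of_mem_closure_of_distB_pos {d : ℕ} {Ω : Set (EuclideanSpace ℝ (Fin d))}
    (hΩ : IsOpen Ω) {y : EuclideanSpace ℝ (Fin d)} (hy : y ∈ closure Ω) (h : 0 < distB Ω y) :
    y ∈ Ω := by
  by_contra hn
  have : y ∈ frontier Ω := by rw [hΩ.frontier_eq]; exact ⟨hy, hn⟩
  exact h.ne' (infDist_zero_of_mem this)

/-- Smooth versions of `χ d_Γ ^ (-σ)`, truncated at distance `ε` from the boundary. The function `D`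
is a smooth substitute for the boundary distance. -/
theorem exists_isCc1_truncated_rpow {d : ℕ} {Ω : Set (EuclideanSpace ℝ (Fin d))} (hΩ : IsOpen Ω)
    {x : EuclideanSpace ℝ (Fin d)} (hx : x ∈ frontier Ω) {U : Set (EuclideanSpace ℝ (Fin d))}
    {r : ℝ} (χ : ContDiffBump x) (hχr : χ.rOut < r) (hχU : closedBall x χ.rOut ⊆ U) {M : ℝ}
    (hM : ∀ y, ‖fderiv ℝ χ y‖ ≤ M) (σ : ℝ) :
    ∃ C : ℝ, 0 ≤ C ∧ ∀ ε τ : ℝ, 0 < ε → 0 < τ → τ ≤ 1 / 4 →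
      ∃ ψ D : EuclideanSpace ℝ (Fin d) → ℝ, IsCc1 (bdryLayer Ω r ∩ U) ψ ∧
        (∀ y, |D y - distB Ω y| ≤ τ * ε) ∧
        (∀ y ∈ Ω, 3 * ε ≤ distB Ω y → ψ y = χ y * D y ^ (-σ)) ∧
        (∀ y ∈ Ω, 3 * ε ≤ distB Ω y →
          ‖fderiv ℝ ψ y‖ ≤ |σ| * χ y * D y ^ (-σ - 1) + M * D y ^ (-σ)) ∧
        (∀ y ∈ Ω, ε / 2 ≤ distB Ω y →
          ‖fderiv ℝ ψ y‖ ≤ C * D y ^ (-σ - 1) + M * D y ^ (-σ)) ∧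
        (∀ y, fderiv ℝ ψ y ≠ 0 → y ∈ Ω ∧ y ∈ closedBall x χ.rOut ∧ ε / 2 ≤ distB Ω y) := by
  obtain ⟨C, hC0, hC⟩ := exists_truncated_rpow σ
  refine ⟨C, hC0, fun ε τ hε hτ hτ4 => ?_⟩
  obtain ⟨f, hf, hf0, hf0', hfle, hfeq, hfd, hfd'⟩ := hC ε hε
  obtain ⟨D, hD, hDd, hD1⟩ := LipschitzWith.exists_contDiff_approx
    (lipschitz_infDist_pt (frontier Ω)) (mul_pos hτ hε)
  change ∀ y, |D y - distB Ω y| ≤ τ * ε at hDd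
  have hτε : τ * ε ≤ ε / 4 := by nlinarith
  have hM0 : 0 ≤ M := (norm_nonneg _).trans (hM x)
  let F : EuclideanSpace ℝ (Fin d) → ℝ := fun y => χ y * f (D y)
  have hF : ContDiff ℝ 1 F := χ.contDiff.mul (hf.comp hD)
  let ψ := Ω.indicator F
  let K := closure Ω ∩ {y | ε / 2 ≤ distB Ω y} ∩ closedBall x χ.rOut
  have hKc : IsClosed K := (isClosed_closure.inter
    (isClosed_le continuous_const (continuous_distB Ω))).inter isClosed_closedBall
  have hKΩ : ∀ y ∈ K, y ∈ Ω := fun y hy =>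
    mem_of_mem_closure_of_distB_pos hΩ hy.1.1 ((half_pos hε).trans_le hy.1.2)
  have hsupp : tsupport ψ ⊆ K := by
    refine closure_minimal (fun y hy => ?_) hKc
    have hyΩ : y ∈ Ω := mem_of_indicator_ne_zero hy
    have hy' : χ y * f (D y) ≠ 0 := by
      have : Ω.indicator F y ≠ 0 := hy
      rwa [indicator_of_mem hyΩ] at this
    refine ⟨⟨subset_closure hyΩ, ?_⟩, ball_subset_closedBall ?_⟩
    · have : ε < D y := by
        by_contra hn
        exact right_ne_zero_of_mul hy' (hf0 _ (not_lt.1 hn))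
      have := (abs_le.1 (hDd y)).2
      change ε / 2 ≤ distB Ω y
      linarith
    · rw [← χ.support_eq]; exact left_ne_zero_of_mul hy'
  have hnear : ∀ y ∈ Ω, ψ =ᶠ[nhds y] F := fun y hy => by
    filter_upwards [hΩ.mem_nhds hy] with z hz using indicator_of_mem hz _
  have hder : ∀ y ∈ Ω, ‖fderiv ℝ ψ y‖ ≤ χ y * |deriv f (D y)| + M * |f (D y)| := fun y hy => by
    have h1 := ((χ.contDiff (n := 1)).differentiable one_ne_zero y).hasFDerivAt.mul
      ((hf.differentiable one_ne_zero (D y)).hasDerivAt.comp_hasFDerivAt y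
        (hD.differentiable one_ne_zero y).hasFDerivAt)
    have h2 : fderiv ℝ F y = _ := h1.fderiv
    rw [(hnear y hy).fderiv_eq, h2]
    refine (norm_add_le _ _).trans (add_le_add ?_ ?_)
    · rw [norm_smul, norm_smul, Real.norm_of_nonneg χ.nonneg, Real.norm_eq_abs]
      exact mul_le_mul_of_nonneg_left (mul_le_of_le_one_right (abs_nonneg _) (hD1 y)) χ.nonneg
    · rw [norm_smul, mul_comm, Real.norm_eq_abs]
      exact mul_le_mul_of_nonneg_right (hM y) (abs_nonneg _)
  refine ⟨ψ, D, ⟨?_, ?_, ?_⟩, hDd, fun y hy h3 => ?_, fun y hy h3 => ?_, fun y hy h3 => ?_,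
    fun y hy => ?_⟩
  · rw [contDiff_iff_contDiffAt]
    intro y
    by_cases hy : y ∈ tsupport ψ
    · exact hF.contDiffAt.congr_of_eventuallyEq (hnear y (hKΩ y (hsupp hy)))
    · exact contDiffAt_const.congr_of_eventuallyEq (notMem_tsupport_iff_eventuallyEq.1 hy)
  · exact HasCompactSupport.of_support_subset_isCompact
      ((isCompact_closedBall x χ.rOut).of_isClosed_subset hKc inter_subset_right)
      (subset_closure.trans hsupp)
  · refine hsupp.trans fun y hy => ⟨⟨hKΩ y hy, ?_⟩, hχU hy.2⟩
    exact ((infDist_le_dist_of_mem hx).trans (mem_closedBall.1 hy.2)).trans_lt hχr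
  · have := (abs_le.1 (hDd y)).1
    change Ω.indicator F y = _
    rw [indicator_of_mem hy]
    simp only [F]
    rw [hfeq _ (by linarith)]
  · have := (abs_le.1 (hDd y)).1
    have h2 : 2 * ε < D y := by linarith
    refine (hder y hy).trans (add_le_add ?_ (mul_le_mul_of_nonneg_left (hfle _ (by linarith)) hM0))
    calc χ y * |deriv f (D y)| ≤ χ y * (|σ| * D y ^ (-σ - 1)) :=
          mul_le_mul_of_nonneg_left (hfd _ h2) χ.nonneg
      _ = _ := by ring
  · have := (abs_le.1 (hDd y)).1
    have hD0 : 0 < D y := by linarith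
    refine (hder y hy).trans (add_le_add ?_ (mul_le_mul_of_nonneg_left ?_ hM0))
    · refine (mul_le_of_le_one_left (abs_nonneg _) χ.le_one).trans ?_
      rcases lt_or_ge (D y) ε with h | h
      · rw [hf0' _ h, abs_zero]; positivity
      · exact hfd' _ h
    · rcases le_or_gt (D y) ε with h | h
      · rw [hf0 _ h, abs_zero]; positivity
      · exact hfle _ h.le
  · have hyK := hsupp (support_fderiv_subset ℝ hy)
    exact ⟨hKΩ y hyK, hyK.2, hyK.1.2⟩

theorem exists_rpow_near_one (σ : ℝ) {θ : ℝ} (hθ : 1 < θ) :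
    ∃ τ : ℝ, 0 < τ ∧ τ ≤ 1 / 4 ∧ ∀ u, |u - 1| ≤ 2 * τ →
      θ⁻¹ ≤ u ^ (-σ) ∧ u ^ (-σ) ≤ θ ∧ u ^ (-σ - 1) ≤ θ := by
  have hc : ∀ p : ℝ, Filter.Tendsto (fun u : ℝ => u ^ p) (nhds 1) (nhds 1) := fun p => by
    have := (Real.continuousAt_rpow_const 1 p (Or.inl one_ne_zero)).tendsto
    rwa [Real.one_rpow] at this
  have h1 := (hc (-σ)).eventually (lt_mem_nhds (inv_lt_one_of_one_lt₀ hθ))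
  have h2 := (hc (-σ)).eventually (gt_mem_nhds hθ)
  have h3 := (hc (-σ - 1)).eventually (gt_mem_nhds hθ)
  obtain ⟨η, hη, H⟩ := Metric.eventually_nhds_iff.1 (h1.and (h2.and h3))
  refine ⟨min (1 / 4) (η / 4), by positivity, min_le_left _ _, fun u hu => ?_⟩
  have : dist u 1 < η := by
    rw [Real.dist_eq]
    have := min_le_right (1 / 4) (η / 4)
    linarith
  obtain ⟨a, b, c⟩ := H this
  exact ⟨a.le, b.le, c.le⟩

theorem rpow_mul_rpow_eq_div_rpow_mul {s t : ℝ} (hs : 0 < s) (ht : 0 < t) (p q : ℝ) :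
    s ^ p * t ^ q = (t / s) ^ q * s ^ (p + q) := by
  rw [Real.div_rpow ht.le hs.le, Real.rpow_add hs]
  have : s ^ q ≠ 0 := by positivity
  field_simp

/-- The critical profile `χ d_Γ ^ (-β / 2)` restricted to the points of `Ω` at distance at least `s`
from the boundary. -/
def criticalProfile {d : ℕ} (Ω : Set (EuclideanSpace ℝ (Fin d)))
    (χ : EuclideanSpace ℝ (Fin d) → ℝ) (β s : ℝ) : EuclideanSpace ℝ (Fin d) → ℝ :=
  (Ω ∩ {y | s ≤ distB Ω y}).indicator fun y => χ y * distB Ω y ^ (-β / 2)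

theorem measurable_criticalProfile {d : ℕ} {Ω : Set (EuclideanSpace ℝ (Fin d))} (hΩ : IsOpen Ω)
    {χ : EuclideanSpace ℝ (Fin d) → ℝ} (hχ : Continuous χ) (β s : ℝ) :
    Measurable (criticalProfile Ω χ β s) :=
  (hχ.measurable.mul ((continuous_distB Ω).measurable.pow_const _)).indicator
    (hΩ.measurableSet.inter (measurableSet_le measurable_const (continuous_distB Ω).measurable))

/-- The Hardy inequality, tested on truncations of `d_Γ ^ (-(β + δ - 2) / 2)`, controls the norm of
the critical profile by itself with factor close to `a |β + δ - 2| / 2`, up to a constant that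
does not depend on the truncation. -/
theorem BHardy.eLpNorm_criticalProfile_le {d : ℕ} {Ω : Set (EuclideanSpace ℝ (Fin d))}
    (hΩ : IsOpen Ω) {x : EuclideanSpace ℝ (Fin d)} (hx : x ∈ frontier Ω)
    {U : Set (EuclideanSpace ℝ (Fin d))} {r : ℝ} (χ : ContDiffBump x) (hχr : χ.rOut < r)
    (hχU : closedBall x χ.rOut ⊆ U) {β δ κ t₀ : ℝ} (hβ : 0 < β) (hκ : 0 ≤ κ) (ht₀ : 0 < t₀)
    (hvol : ∀ t ∈ Ioo 0 t₀, volume (Ω ∩ closedBall x χ.rOut ∩ {y | distB Ω y < t}) ≤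
      ENNReal.ofReal (κ * t ^ β))
    {a : ℝ} (hH : BHardy Ω δ (bdryLayer Ω r ∩ U) a) {θ : ℝ} (hθ : 1 < θ) :
    ∃ B : ℝ≥0∞, B ≠ ⊤ ∧ ∀ ε, 0 < ε → 3 * ε < t₀ →
      eLpNorm (criticalProfile Ω χ β (3 * ε)) 2 volume ≤ ENNReal.ofReal θ * (ENNReal.ofReal a *
        (ENNReal.ofReal (θ * |(β + δ - 2) / 2|) *
          eLpNorm (criticalProfile Ω χ β (3 * ε)) 2 volume + B)) := by
  set σ := (β + δ - 2) / 2 with hσ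
  have hθ0 : 0 < θ := by linarith
  obtain ⟨M, hM⟩ := (χ.contDiff.continuous_fderiv (one_ne_zero)).bounded_above_of_compact_support
    (χ.hasCompactSupport.fderiv ℝ)
  have hM0 : 0 ≤ M := (norm_nonneg _).trans (hM x)
  obtain ⟨C, hC0, hC⟩ := exists_isCc1_truncated_rpow hΩ hx χ hχr hχU hM σ
  obtain ⟨τ, hτ, hτ4, hu⟩ := exists_rpow_near_one σ hθ
  let E := Ω ∩ closedBall x χ.rOut
  have hE : MeasurableSet E := hΩ.measurableSet.inter measurableSet_closedBall
  have hmd : Measurable (distB Ω) := (continuous_distB Ω).measurable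
  let g₀ : EuclideanSpace ℝ (Fin d) → ℝ := E.indicator fun y => distB Ω y ^ (1 - β / 2)
  have hg₀ : Measurable g₀ := (hmd.pow_const _).indicator hE
  have hN₀ : eLpNorm g₀ 2 volume ≠ ⊤ :=
    eLpNorm_indicator_rpow_ne_top hmd hE
      ((measure_mono inter_subset_right).trans_lt measure_closedBall_lt_top).ne
      (fun y hy => distB_pos hΩ ⟨x, hx⟩ hy.1)
      (fun y hy => (infDist_le_dist_of_mem hx).trans (mem_closedBall.1 hy.2)) hβ ht₀ hvol
  refine ⟨‖θ * M‖ₑ * eLpNorm g₀ 2 volume + ENNReal.ofReal (θ * C * (6 ^ (β / 2) * √κ)),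
    by finiteness, fun ε hε hεt => ?_⟩
  obtain ⟨ψ, D, hψ, hD, hψeq, hgrad, hgrad', hsupp⟩ := hC ε τ hε hτ hτ4
  have hratio : ∀ y ∈ Ω, ε / 2 ≤ distB Ω y → |D y / distB Ω y - 1| ≤ 2 * τ ∧ 0 < D y :=
    fun y hy h => by
      have h0 := distB_pos hΩ ⟨x, hx⟩ hy
      have h1 := hD y
      constructor
      · rw [div_sub_one h0.ne', abs_div, abs_of_pos h0, div_le_iff₀ h0]
        nlinarith
      · have := (abs_le.1 h1).1
        nlinarith
  set h := criticalProfile Ω χ β (3 * ε) with hh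
  have hhm : Measurable h := measurable_criticalProfile hΩ χ.continuous β (3 * ε)
  let g₃ : EuclideanSpace ℝ (Fin d) → ℝ :=
    (E ∩ {y | distB Ω y < 3 * ε}).indicator fun _ => θ * C * (ε / 2) ^ (-β / 2)
  have hS : MeasurableSet (E ∩ {y | distB Ω y < 3 * ε}) :=
    hE.inter (measurableSet_lt hmd measurable_const)
  have hg₃ : Measurable g₃ := measurable_const.indicator hS
  have hh0 : ∀ y, 0 ≤ h y := fun y =>
    indicator_nonneg (fun z _ => mul_nonneg χ.nonneg (Real.rpow_nonneg infDist_nonneg _)) y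
  have hg₀0 : ∀ y, 0 ≤ g₀ y := fun y =>
    indicator_nonneg (fun z _ => Real.rpow_nonneg infDist_nonneg _) y
  have hg₃0 : ∀ y, 0 ≤ g₃ y := fun y => indicator_nonneg (fun z _ => by positivity) y
  have hlow : eLpNorm h 2 volume ≤ ENNReal.ofReal θ * wNorm Ω (δ / 2 - 1) ψ := by
    rw [← Real.enorm_of_nonneg hθ0.le, wNorm, L2N, ← eLpNorm_const_smul]
    refine eLpNorm_mono fun y => ?_
    by_cases hy : y ∈ Ω ∩ {y | 3 * ε ≤ distB Ω y}
    · have h3 : 3 * ε ≤ distB Ω y := hy.2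
      obtain ⟨hr, hD0⟩ := hratio y hy.1 (by linarith)
      have h0 := distB_pos hΩ ⟨x, hx⟩ hy.1
      have e : distB Ω y ^ (δ / 2 - 1) * (χ y * D y ^ (-σ)) =
          χ y * ((D y / distB Ω y) ^ (-σ) * distB Ω y ^ (-β / 2)) := by
        rw [mul_left_comm, rpow_mul_rpow_eq_div_rpow_mul h0 hD0,
          show δ / 2 - 1 + -σ = -β / 2 by rw [hσ]; ring]
      have hq : h y = χ y * distB Ω y ^ (-β / 2) := indicator_of_mem hy _
      have hχ0 : 0 ≤ χ y := χ.nonneg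
      rw [Pi.smul_apply, smul_eq_mul, hψeq y hy.1 h3, e, hq,
        Real.norm_of_nonneg (by positivity), Real.norm_of_nonneg (by positivity)]
      calc χ y * distB Ω y ^ (-β / 2)
          = θ * (χ y * (θ⁻¹ * distB Ω y ^ (-β / 2))) := by field_simp
        _ ≤ _ := by gcongr; exact (hu _ hr).1
    · have hq : h y = 0 := indicator_of_notMem hy _
      rw [hq, norm_zero]
      exact norm_nonneg _
  have hup : wGradNorm Ω (δ / 2) ψ ≤
      ENNReal.ofReal (θ * |σ|) * eLpNorm h 2 volume +
        (‖θ * M‖ₑ * eLpNorm g₀ 2 volume + ENNReal.ofReal (θ * C * (6 ^ (β / 2) * √κ))) := by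
    have hpt : ∀ y, ‖distB Ω y ^ (δ / 2) * ‖fderiv ℝ ψ y‖‖ ≤
        (((θ * |σ|) • h) + (((θ * M) • g₀) + g₃)) y := by
      intro y
      simp only [Pi.add_apply, Pi.smul_apply, smul_eq_mul]
      have hh0 := hh0 y
      have hg₀0 := hg₀0 y
      have hg₃0 := hg₃0 y
      have hdn : 0 ≤ distB Ω y := infDist_nonneg
      by_cases hy : fderiv ℝ ψ y = 0
      · rw [hy, norm_zero, mul_zero, norm_zero]; positivity
      obtain ⟨hyΩ, hyB, hε2⟩ := hsupp y hy
      have h0 := distB_pos hΩ ⟨x, hx⟩ hyΩ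
      obtain ⟨hr, hD0⟩ := hratio y hyΩ hε2
      obtain ⟨-, hu1, hu2⟩ := hu _ hr
      have hχ0 : 0 ≤ χ y := χ.nonneg
      have hg₀y : g₀ y = distB Ω y ^ (1 - β / 2) :=
        indicator_of_mem (show y ∈ E from ⟨hyΩ, hyB⟩) _
      have e1 : distB Ω y ^ (δ / 2) * D y ^ (-σ - 1) ≤ θ * distB Ω y ^ (-β / 2) := by
        rw [rpow_mul_rpow_eq_div_rpow_mul h0 hD0,
          show δ / 2 + (-σ - 1) = -β / 2 by rw [hσ]; ring]
        gcongr
      have e2 : distB Ω y ^ (δ / 2) * D y ^ (-σ) ≤ θ * g₀ y := by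
        rw [rpow_mul_rpow_eq_div_rpow_mul h0 hD0, hg₀y,
          show δ / 2 + -σ = 1 - β / 2 by rw [hσ]; ring]
        gcongr
      have e3 := mul_le_mul_of_nonneg_left e2 hM0
      rw [Real.norm_of_nonneg (by positivity)]
      have hw : 0 ≤ distB Ω y ^ (δ / 2) := by positivity
      rcases le_or_gt (3 * ε) (distB Ω y) with h3 | h3
      · have hhy : h y = χ y * distB Ω y ^ (-β / 2) :=
          indicator_of_mem (show y ∈ Ω ∩ {y | 3 * ε ≤ distB Ω y} from ⟨hyΩ, h3⟩) _
        have e4 := mul_le_mul_of_nonneg_left e1 (mul_nonneg (abs_nonneg σ) hχ0)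
        have e5 := mul_le_mul_of_nonneg_left (hgrad y hyΩ h3) hw
        rw [hhy]
        linarith
      · have hg₃y : g₃ y = θ * C * (ε / 2) ^ (-β / 2) :=
          indicator_of_mem (show y ∈ E ∩ {y | distB Ω y < 3 * ε} from ⟨⟨hyΩ, hyB⟩, h3⟩) _
        have e4 := mul_le_mul_of_nonneg_left e1 hC0
        have e5 := mul_le_mul_of_nonneg_left (hgrad' y hyΩ hε2) hw
        have e6 : distB Ω y ^ (-β / 2) ≤ (ε / 2) ^ (-β / 2) :=
          Real.rpow_le_rpow_of_nonpos (by positivity) hε2 (by linarith)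
        have e7 := mul_le_mul_of_nonneg_left e6 (mul_nonneg hθ0.le hC0)
        have e8 : 0 ≤ θ * |σ| * h y := by positivity
        rw [hg₃y]
        linarith
    refine (eLpNorm_mono_real hpt).trans ?_
    refine (eLpNorm_add_le (hhm.const_smul _).aestronglyMeasurable
      ((hg₀.const_smul _).add hg₃).aestronglyMeasurable one_le_two).trans ?_
    gcongr
    · rw [eLpNorm_const_smul, Real.enorm_of_nonneg (by positivity)]
    refine (eLpNorm_add_le (hg₀.const_smul _).aestronglyMeasurable
      hg₃.aestronglyMeasurable one_le_two).trans ?_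
    gcongr
    · rw [eLpNorm_const_smul]
    · rw [eLpNorm_indicator_const hS two_ne_zero ENNReal.ofNat_ne_top,
        Real.enorm_of_nonneg (by positivity)]
      calc ENNReal.ofReal (θ * C * (ε / 2) ^ (-β / 2)) *
            volume (E ∩ {y | distB Ω y < 3 * ε}) ^ (1 / (2 : ℝ≥0∞).toReal)
          ≤ ENNReal.ofReal (θ * C * (ε / 2) ^ (-β / 2)) *
            ENNReal.ofReal (κ * (3 * ε) ^ β) ^ (1 / (2 : ℝ≥0∞).toReal) := by
            gcongr; exact hvol _ ⟨by positivity, hεt⟩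
        _ = _ := by
            rw [ENNReal.ofReal_rpow_of_nonneg (by positivity) (by positivity),
              ← ENNReal.ofReal_mul (by positivity)]
            congr 1
            have s1 : (3 * ε) ^ β = (6 ^ (β / 2) * (ε / 2) ^ (β / 2)) ^ 2 := by
              rw [← Real.mul_rpow (by norm_num) (by positivity), ← Real.rpow_natCast,
                ← Real.rpow_mul (by positivity)]
              congr 1 <;> (push_cast; ring)
            have s2 : (ε / 2) ^ (-β / 2) * (ε / 2) ^ (β / 2) = 1 := by
              rw [← Real.rpow_add (by positivity)]
              simp [neg_div]
            rw [ENNReal.toReal_ofNat, ← Real.sqrt_eq_rpow, s1, Real.sqrt_mul hκ,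
              Real.sqrt_sq (by positivity)]
            linear_combination (θ * C * 6 ^ (β / 2) * √κ) * s2
  calc eLpNorm h 2 volume ≤ ENNReal.ofReal θ * wNorm Ω (δ / 2 - 1) ψ := hlow
    _ ≤ ENNReal.ofReal θ * (ENNReal.ofReal a * wGradNorm Ω (δ / 2) ψ) := by
        gcongr; exact hH ψ hψ
    _ ≤ _ := by gcongr

theorem eLpNorm_criticalProfile_ne_top {d : ℕ} {Ω : Set (EuclideanSpace ℝ (Fin d))}
    {x : EuclideanSpace ℝ (Fin d)} (χ : ContDiffBump x) {β s : ℝ} (hβ : 0 < β) (hs : 0 < s) :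
    eLpNorm (criticalProfile Ω χ β s) 2 volume ≠ ⊤ := by
  have hle : eLpNorm (criticalProfile Ω χ β s) 2 volume ≤
      eLpNorm ((closedBall x χ.rOut).indicator fun _ => s ^ (-β / 2)) 2 volume := by
    refine eLpNorm_mono fun y => ?_
    by_cases hy : y ∈ Ω ∩ {y | s ≤ distB Ω y}
    · have hsy : s ≤ distB Ω y := hy.2
      rw [criticalProfile, indicator_of_mem hy]
      by_cases hyB : y ∈ closedBall x χ.rOut
      · have : 0 < distB Ω y := hs.trans_le hsy
        have hχ0 : 0 ≤ χ y := χ.nonneg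
        rw [indicator_of_mem hyB, Real.norm_of_nonneg (by positivity),
          Real.norm_of_nonneg (by positivity)]
        exact (mul_le_of_le_one_left (by positivity) χ.le_one).trans
          (Real.rpow_le_rpow_of_nonpos hs hsy (by linarith))
      · rw [χ.zero_of_le_dist (not_le.1 hyB).le, zero_mul, norm_zero]
        exact norm_nonneg _
    · rw [criticalProfile, indicator_of_notMem hy, norm_zero]
      exact norm_nonneg _
  refine (hle.trans_lt ?_).ne
  rw [eLpNorm_indicator_const measurableSet_closedBall two_ne_zero ENNReal.ofNat_ne_top]
  exact ENNReal.mul_lt_top enorm_lt_top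
    (ENNReal.rpow_lt_top_of_nonneg (by positivity) measure_closedBall_lt_top.ne)

theorem infDist_frontier_inter_ball_lt {d : ℕ} {Ω : Set (EuclideanSpace ℝ (Fin d))}
    {x y : EuclideanSpace ℝ (Fin d)} (hx : x ∈ frontier Ω) {ρ t : ℝ} (hy : dist y x ≤ ρ)
    (ht : t ≤ ρ) (h : distB Ω y < t) : infDist y (frontier Ω ∩ ball x (2 * ρ)) < t := by
  obtain ⟨z, hz, hyz⟩ := (infDist_lt_iff (s := frontier Ω) ⟨x, hx⟩).1 h
  have hzx : z ∈ frontier Ω ∩ ball x (2 * ρ) := by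
    refine ⟨hz, mem_ball.2 ?_⟩
    have := dist_triangle_left z x y
    linarith
  exact (infDist_le_dist_of_mem hzx).trans_lt hyz

theorem distB_lt_of_infDist_frontier_inter_ball_lt {d : ℕ} {Ω : Set (EuclideanSpace ℝ (Fin d))}
    {x y : EuclideanSpace ℝ (Fin d)} (hx : x ∈ frontier Ω) {ρ t : ℝ} (hρ : 0 < ρ)
    (h : infDist y (frontier Ω ∩ ball x ρ) < t) : distB Ω y < t ∧ dist y x < t + ρ := by
  obtain ⟨z, hz, hyz⟩ := (infDist_lt_iff (s := frontier Ω ∩ ball x ρ) ⟨x, hx, mem_ball_self hρ⟩).1 h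
  refine ⟨(infDist_le_dist_of_mem hz.1).trans_lt hyz, ?_⟩
  have := dist_triangle y z x
  have := mem_ball.1 hz.2
  linarith

/-- The norm of the critical profile diverges as the truncation is removed. -/
theorem exists_natCast_mul_le_eLpNorm_criticalProfile {d : ℕ}
    {Ω : Set (EuclideanSpace ℝ (Fin d))} (hΩ : IsOpen Ω) {x : EuclideanSpace ℝ (Fin d)}
    (χ : ContDiffBump x) {β κ κ' t₀ : ℝ} (hβ : 0 < β) (hκ' : 0 < κ') (ht₀ : 0 < t₀)
    (hup : ∀ t ∈ Ioo 0 t₀, volume (closure Ω ∩ closedBall x χ.rIn ∩ {y | distB Ω y < t}) ≤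
      ENNReal.ofReal (κ * t ^ β))
    (hlow : ∀ t ∈ Ioo 0 t₀, ENNReal.ofReal (κ' * t ^ β) ≤
      volume (closure Ω ∩ closedBall x χ.rIn ∩ {y | distB Ω y < t})) :
    ∃ c : ℝ≥0∞, c ≠ 0 ∧ ∀ n : ℕ, ∃ s ∈ Ioo 0 t₀,
      n * c ≤ eLpNorm (criticalProfile Ω χ β s) 2 volume ^ 2 := by
  obtain ⟨q, hq0, hq1, hq⟩ : ∃ q : ℝ, 0 < q ∧ q < 1 ∧ κ * q ^ β ≤ κ' / 2 := by
    have hc : Filter.Tendsto (fun q : ℝ => κ * q ^ β) (nhdsWithin 0 (Ioi 0)) (nhds 0) := by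
      have := ((Real.continuousAt_rpow_const 0 β (Or.inr hβ.le)).tendsto.const_mul κ).mono_left
        (nhdsWithin_le_nhds (s := Ioi 0))
      rwa [Real.zero_rpow hβ.ne', mul_zero] at this
    obtain ⟨q, hq, hq'⟩ := ((hc.eventually (gt_mem_nhds (half_pos hκ'))).and
      (Ioo_mem_nhdsGT one_pos)).exists
    exact ⟨q, hq'.1, hq'.2, hq.le⟩
  let T : ℕ → ℝ := fun k => q ^ k * (t₀ / 2)
  have hT0 : ∀ k, 0 < T k := fun k => by positivity
  have hTs : ∀ k, T (k + 1) = q * T k := fun k => by simp only [T]; ring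
  have hTanti : Antitone T := antitone_nat_of_succ_le fun k => by
    rw [hTs]; exact mul_le_of_le_one_left (hT0 k).le hq1.le
  have hTt : ∀ k, T k ∈ Ioo 0 t₀ := fun k => by
    refine ⟨hT0 k, (hTanti (Nat.zero_le k)).trans_lt ?_⟩
    simp only [T, pow_zero]
    linarith
  have hmd : Measurable (distB Ω) := (continuous_distB Ω).measurable
  let A : ℕ → Set (EuclideanSpace ℝ (Fin d)) := fun k =>
    Ω ∩ closedBall x χ.rIn ∩ {y | T (k + 1) ≤ distB Ω y ∧ distB Ω y < T k}
  have hA : ∀ k, MeasurableSet (A k) := fun k =>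
    (hΩ.measurableSet.inter measurableSet_closedBall).inter
      ((measurableSet_le measurable_const hmd).inter (measurableSet_lt hmd measurable_const))
  have hdisj : Pairwise fun i j => Disjoint (A i) (A j) := by
    have aux : ∀ i j, i < j → Disjoint (A i) (A j) := fun i j hij =>
      Set.disjoint_left.2 fun y hi hj => by
        have h1 : T (i + 1) ≤ distB Ω y := hi.2.1
        have h2 : distB Ω y < T j := hj.2.2
        exact absurd (hTanti (Nat.succ_le_of_lt hij)) (not_le.2 (h1.trans_lt h2))
    intro i j hij
    rcases lt_or_gt_of_ne hij with h | h
    · exact aux i j h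
    · exact (aux j i h).symm
  have hvol : ∀ k, ENNReal.ofReal (κ' / 2 * T k ^ β) ≤ volume (A k) := fun k => by
    have hsub : closure Ω ∩ closedBall x χ.rIn ∩ {y | distB Ω y < T k} ⊆
        A k ∪ closure Ω ∩ closedBall x χ.rIn ∩ {y | distB Ω y < T (k + 1)} := by
      intro y hy
      rcases lt_or_ge (distB Ω y) (T (k + 1)) with h | h
      · exact Or.inr ⟨hy.1, h⟩
      · exact Or.inl ⟨⟨mem_of_mem_closure_of_distB_pos hΩ hy.1.1 ((hT0 _).trans_le h), hy.1.2⟩,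
          h, hy.2⟩
    have h1 : ENNReal.ofReal (κ' * T k ^ β) ≤
        volume (A k) + ENNReal.ofReal (κ' / 2 * T k ^ β) := by
      refine (hlow _ (hTt k)).trans ((measure_mono hsub).trans ((measure_union_le _ _).trans ?_))
      gcongr
      refine (hup _ (hTt (k + 1))).trans (ENNReal.ofReal_le_ofReal ?_)
      rw [hTs, Real.mul_rpow hq0.le (hT0 k).le, ← mul_assoc]
      exact mul_le_mul_of_nonneg_right hq (Real.rpow_nonneg (hT0 k).le _)
    have hnn : 0 ≤ κ' / 2 * T k ^ β := mul_nonneg (by positivity) (Real.rpow_nonneg (hT0 k).le _)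
    rw [show κ' * T k ^ β = κ' / 2 * T k ^ β + κ' / 2 * T k ^ β by ring,
      ENNReal.ofReal_add hnn hnn] at h1
    exact (ENNReal.add_le_add_iff_right ENNReal.ofReal_ne_top).1 h1
  refine ⟨ENNReal.ofReal (κ' / 2), by simpa using hκ', fun n => ⟨T n, hTt n, ?_⟩⟩
  refine natCast_mul_le_eLpNorm_two_sq hA hdisj (b := fun k => ENNReal.ofReal (T k ^ (-β / 2)))
    (fun k hk y hy => ?_) fun k _ => ?_
  · have h1 : T (k + 1) ≤ distB Ω y := hy.2.1
    have h2 : distB Ω y < T k := hy.2.2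
    have h0 : 0 < distB Ω y := (hT0 _).trans_le h1
    have hmem : y ∈ Ω ∩ {y | T n ≤ distB Ω y} :=
      ⟨hy.1.1, (hTanti (Nat.succ_le_of_lt hk)).trans h1⟩
    rw [criticalProfile, indicator_of_mem hmem, χ.one_of_mem_closedBall hy.1.2, one_mul,
      Real.enorm_of_nonneg (by positivity)]
    exact ENNReal.ofReal_le_ofReal (Real.rpow_le_rpow_of_nonpos h0 h2.le (by linarith))
  · calc ENNReal.ofReal (κ' / 2)
        = ENNReal.ofReal (T k ^ (-β / 2)) ^ 2 * ENNReal.ofReal (κ' / 2 * T k ^ β) := by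
          have := hT0 k
          rw [← ENNReal.ofReal_pow (by positivity), ← ENNReal.ofReal_mul (by positivity)]
          congr 1
          have e : (T k ^ (-β / 2)) ^ 2 * T k ^ β = 1 := by
            rw [← Real.rpow_natCast, ← Real.rpow_mul this.le, ← Real.rpow_add this]
            norm_num
          linear_combination (-κ' / 2) * e
      _ ≤ _ := by gcongr; exact hvol k

/-- At an Ahlfors point with exponent `β`, every constant in a Hardy inequality with weight
exponent `δ` near the point is at least `2 / |β + δ - 2|`. -/
theorem BHardy.two_div_abs_le {d : ℕ} {Ω : Set (EuclideanSpace ℝ (Fin d))} (hΩ : IsOpen Ω)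
    {β : ℝ} (hβ : 0 < β) {x : EuclideanSpace ℝ (Fin d)} (hx : AhlforsPoint Ω β x) {δ : ℝ}
    {U : Set (EuclideanSpace ℝ (Fin d))} (hUo : IsOpen U) (hxU : x ∈ U) {r a : ℝ} (hr : 0 < r)
    (ha : 0 < a) (hH : BHardy Ω δ (bdryLayer Ω r ∩ U) a) :
    2 / |β + δ - 2| ≤ a := by
  by_contra! hlt
  obtain ⟨hxΓ, s₀, hs₀, hs⟩ := hx
  obtain ⟨ρ₀, hρ₀, hball⟩ := Metric.isOpen_iff.1 hUo x hxU
  obtain ⟨ρ, hρ, hρr, hρρ, hρs⟩ : ∃ ρ > 0, ρ < r ∧ ρ < ρ₀ ∧ 2 * ρ < s₀ := by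
    obtain ⟨ρ, h0, h⟩ := exists_between
      (lt_min hr (lt_min hρ₀ (half_pos hs₀)))
    simp only [lt_min_iff] at h
    exact ⟨ρ, h0, h.1, h.2.1, by linarith⟩
  obtain ⟨κ, _, hκ, -, r₁, hr₁, hup⟩ := hs (2 * ρ) ⟨by positivity, hρs⟩
  obtain ⟨_, κ', -, hκ', r₂, hr₂, hlow⟩ := hs (ρ / 4) ⟨by positivity, by linarith⟩
  let χ : ContDiffBump x := ⟨ρ / 2, ρ, half_pos hρ, half_lt_self hρ⟩
  let t₀ := min (ρ / 4) (min r₁ r₂)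
  have ht₀ : 0 < t₀ := by positivity
  have hvup : ∀ t ∈ Ioo 0 t₀, volume (closure Ω ∩ closedBall x ρ ∩ {y | distB Ω y < t}) ≤
      ENNReal.ofReal (κ * t ^ β) := fun t ht => by
    have h := lt_min_iff.1 ht.2
    refine (measure_mono fun y hy => ?_).trans (hup t ⟨ht.1, (lt_min_iff.1 h.2).1⟩).2
    exact ⟨hy.1.1, infDist_frontier_inter_ball_lt hxΓ (mem_closedBall.1 hy.1.2)
      (by linarith [h.1]) hy.2⟩
  have hvlow : ∀ t ∈ Ioo 0 t₀, ENNReal.ofReal (κ' * t ^ β) ≤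
      volume (closure Ω ∩ closedBall x χ.rIn ∩ {y | distB Ω y < t}) := fun t ht => by
    have h := lt_min_iff.1 ht.2
    refine (hlow t ⟨ht.1, (lt_min_iff.1 h.2).2⟩).1.trans (measure_mono fun y hy => ?_)
    obtain ⟨h1, h2⟩ := distB_lt_of_infDist_frontier_inter_ball_lt hxΓ (by positivity) hy.2
    refine ⟨⟨hy.1, mem_closedBall.2 ?_⟩, h1⟩
    change dist y x ≤ ρ / 2
    linarith [h.1]
  have hp : a * |(β + δ - 2) / 2| < 1 := by
    have hγ : 0 < |β + δ - 2| := by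
      refine (abs_nonneg _).lt_of_ne fun h => ?_
      rw [← h, _root_.div_zero] at hlt
      linarith
    rw [lt_div_iff₀ hγ] at hlt
    rw [abs_div, abs_two]
    linarith
  obtain ⟨θ, hθ, hθp⟩ : ∃ θ : ℝ, 1 < θ ∧ θ * (a * (θ * |(β + δ - 2) / 2|)) < 1 := by
    have hc : ContinuousAt (fun θ : ℝ => θ * (a * (θ * |(β + δ - 2) / 2|))) 1 := by fun_prop
    have hev := (hc.eventually (gt_mem_nhds (by simpa using hp))).filter_mono
      (nhdsWithin_le_nhds (s := Ioi 1))
    obtain ⟨θ, h1, h2⟩ := (hev.and self_mem_nhdsWithin).exists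
    exact ⟨θ, h2, h1⟩
  have hθ0 : 0 < θ := by linarith
  obtain ⟨B, hB, hle⟩ := hH.eLpNorm_criticalProfile_le hΩ hxΓ χ hρr
    ((closedBall_subset_ball hρρ).trans hball) hβ hκ.le ht₀ (fun t ht => (measure_mono
      (inter_subset_inter_left _ (inter_subset_inter_left _ subset_closure))).trans (hvup t ht)) hθ
  obtain ⟨c, hc, hdiv⟩ := exists_natCast_mul_le_eLpNorm_criticalProfile hΩ χ hβ hκ' ht₀
    (fun t ht => (measure_mono (inter_subset_inter_left _ (inter_subset_inter_right _
      (closedBall_subset_closedBall (half_le_self hρ.le))))).trans (hvup t ht)) hvlow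
  let p := θ * (a * (θ * |(β + δ - 2) / 2|))
  let Q := ENNReal.ofReal (θ * a * B.toReal / (1 - p))
  have hQ : ∀ s ∈ Ioo 0 t₀, eLpNorm (criticalProfile Ω χ β s) 2 volume ≤ Q := fun s hs => by
    have h := hle (s / 3) (by linarith [hs.1]) (by linarith [hs.2])
    rw [mul_div_cancel₀ s three_ne_zero] at h
    have hN : eLpNorm (criticalProfile Ω χ β s) 2 volume ≠ ⊤ :=
      eLpNorm_criticalProfile_ne_top χ hβ hs.1
    set N := eLpNorm (criticalProfile Ω χ β s) 2 volume
    have h' := ENNReal.toReal_mono (by finiteness) h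
    rw [ENNReal.toReal_mul, ENNReal.toReal_mul, ENNReal.toReal_add (by finiteness) hB,
      ENNReal.toReal_mul, ENNReal.toReal_ofReal hθ0.le, ENNReal.toReal_ofReal ha.le,
      ENNReal.toReal_ofReal (by positivity)] at h'
    refine ENNReal.le_ofReal_iff_toReal_le hN (by
      have : 0 < 1 - p := sub_pos.2 hθp
      positivity) |>.2 ?_
    rw [le_div_iff₀ (sub_pos.2 hθp)]
    change N.toReal * (1 - θ * (a * (θ * |(β + δ - 2) / 2|))) ≤ _
    linarith
  have hQ2 : Q ^ 2 / c ≠ ⊤ := ENNReal.div_ne_top (by finiteness) hc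
  obtain ⟨n, hn⟩ := ENNReal.exists_nat_gt hQ2
  obtain ⟨s, hs, hns⟩ := hdiv n
  have hnQ : n * c ≤ Q ^ 2 := hns.trans (pow_le_pow_left₀ zero_le (hQ s hs) 2)
  exact absurd (ENNReal.le_div_iff_mul_le (Or.inl hc) (Or.inr (by finiteness)) |>.2 hnQ)
    (not_le.2 hn)

/-- If `x ∈ Γ` is an Ahlfors point with exponent `β ∈ (0,d]`, `δ ≥ 0` with
`δ ≠ 2-β`, and `U` is a bounded open set containing `x`, then any constant `a > 0` for
which the Hardy inequality holds on `Γ_r ∩ U` satisfies `a ≥ 2/|β+δ-2|`; in particular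
the local Hardy constant `a_δ(x) = inf{a_δ(Γ∩V) : V ⊆ U bounded open, x ∈ V}` is at
least `2/|β+δ-2|`. -/
theorem stmt7 {d : ℕ} (hd : 1 ≤ d) (Ω : Set (EuclideanSpace ℝ (Fin d)))
    (hΩ : IsDomainSet Ω) (β : ℝ) (hβ : β ∈ Set.Ioc (0:ℝ) (d:ℝ))
    (x : EuclideanSpace ℝ (Fin d)) (hx : AhlforsPoint Ω β x)
    (δ : ℝ) (hδ0 : 0 ≤ δ) (hδβ : δ ≠ 2 - β)
    (U : Set (EuclideanSpace ℝ (Fin d))) (hUo : IsOpen U)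
    (hUb : Bornology.IsBounded U) (hxU : x ∈ U)
    (r a : ℝ) (hr : 0 < r) (ha : 0 < a)
    (hH : BHardy Ω δ (bdryLayer Ω r ∩ U) a) :
    2 / |β + δ - 2| ≤ a ∧
    ENNReal.ofReal (2 / |β + δ - 2|) ≤
      sInf {t : ℝ≥0∞ | ∃ V : Set (EuclideanSpace ℝ (Fin d)),
        V ⊆ U ∧ IsOpen V ∧ Bornology.IsBounded V ∧ x ∈ V ∧ t = hardyConstOn Ω δ V} := by
  refine ⟨hH.two_div_abs_le hΩ.1 hβ.1 hx hUo hxU hr ha, le_sInf ?_⟩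
  rintro t ⟨V, -, hVo, -, hxV, rfl⟩
  refine le_iInf₂ fun r' hr' => le_sInf ?_
  rintro t ⟨a', ha', rfl, hH'⟩
  exact ENNReal.ofReal_le_ofReal (hH'.two_div_abs_le hΩ.1 hβ.1 hx hVo hxV hr' ha')
end
end

section
/- Let U ⊆ ℝ^d be a bounded open set and u > 0, and suppose the two-sided ball condition with radius u holds at every point y ∈ Γ ∩ U, so that d_Γ is C^{1,1} on Γ_u ∩ U (hence lies in W^{2,∞}_loc(Γ_u ∩ U)). Let 0 < r < u/2 and assume every point of Γ_r ∩ U has its (unique) nearest boundary point in Γ ∩ U. Then |∫_Ω (∇ψ)·(∇d_Γ)| ≤ 2(d−1) u^{−1} ‖ψ‖_1 for all ψ ∈ C_c^1(Γ_r ∩ U). -/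
open MeasureTheory Metric Set ENNReal RealInnerProductSpace

noncomputable section

/-- The two-sided (interior and exterior) ball condition with radius `u` at `y ∈ Γ`:
there is an interior ball `B̄(z;u) ⊆ Ω ∪ {y}` touching `Γ` exactly at `y`, and an
exterior ball touching `Ω̄` exactly at `y`. -/
def TwoSidedBall {d : ℕ} (Ω : Set (EuclideanSpace ℝ (Fin d))) (u : ℝ)
    (y : EuclideanSpace ℝ (Fin d)) : Prop :=
  (∃ z ∈ Ω, Metric.closedBall z u ∩ Ωᶜ = {y}) ∧
  (∃ z' ∈ (closure Ω)ᶜ, Metric.closedBall z' u ∩ closure Ω = {y})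

section SecondDifference

lemma sqrt_one_add_le {s : ℝ} (hs : -1 ≤ s) :
    √(1 + s) ≤ 1 + s / 2 - s ^ 2 / 8 + s ^ 3 / 16 := by
  apply Real.sqrt_le_iff.mpr
  constructor
  · nlinarith [mul_nonneg (sq_nonneg s) (by linarith : 0 ≤ s + 1), sq_nonneg (s - 2)]
  · have h : 0 ≤ s ^ 4 * (5 / 64 - s / 64 + s ^ 2 / 256) := by
      apply mul_nonneg (by positivity)
      nlinarith [sq_nonneg (s - 2)]
    nlinarith

variable {E : Type*} [NormedAddCommGroup E] [InnerProductSpace ℝ E]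

/-- The second difference of the norm is bounded by its second derivative plus a
fourth-order error. -/
lemma norm_add_add_norm_sub_le {p e : E} (hp : 0 < ‖p‖) (he : ‖e‖ ≤ ‖p‖) :
    ‖p + e‖ + ‖p - e‖ - 2 * ‖p‖
      ≤ (‖e‖ ^ 2 - ⟪p, e⟫ ^ 2 / ‖p‖ ^ 2) / ‖p‖ + 2 * ‖e‖ ^ 4 / ‖p‖ ^ 3 := by
  set ρ := ‖p‖ with hρ
  set q := ⟪p, e⟫ / ρ ^ 2 with hq
  set η := ‖e‖ ^ 2 / ρ ^ 2 with hη
  have hη0 : 0 ≤ η := by positivity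
  have hη1 : η ≤ 1 := by
    rw [hη, div_le_one (by positivity)]
    exact pow_le_pow_left₀ (norm_nonneg _) he 2
  have hqη : q ^ 2 ≤ η := by
    have h := abs_real_inner_le_norm p e
    have h2 : ⟪p, e⟫ ^ 2 ≤ ρ ^ 2 * ‖e‖ ^ 2 := by
      rw [← mul_pow, ← sq_abs]
      exact pow_le_pow_left₀ (abs_nonneg _) h 2
    rw [hq, hη, div_pow, div_le_div_iff₀ (by positivity) (by positivity)]
    nlinarith [mul_le_mul_of_nonneg_right h2 (sq_nonneg ρ)]
  have hi : ⟪p, e⟫ = ρ ^ 2 * q := by rw [hq]; field_simp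
  have he2 : ‖e‖ ^ 2 = ρ ^ 2 * η := by rw [hη]; field_simp
  have key : ∀ v : E, ∀ s : ℝ, ‖v‖ ^ 2 = ρ ^ 2 * (1 + s) →
      ‖v‖ ≤ ρ * (1 + s / 2 - s ^ 2 / 8 + s ^ 3 / 16) := by
    intro v s hv
    have hs : 0 ≤ 1 + s := by
      have h1 : 0 ≤ ρ ^ 2 * (1 + s) := hv ▸ sq_nonneg _
      exact nonneg_of_mul_nonneg_right h1 (by positivity)
    have : ‖v‖ = ρ * √(1 + s) := by
      rw [← Real.sqrt_sq (norm_nonneg v), hv, Real.sqrt_mul (by positivity),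
        Real.sqrt_sq hp.le]
    rw [this]
    exact mul_le_mul_of_nonneg_left (sqrt_one_add_le (by linarith)) hp.le
  have h1 := key (p + e) (2 * q + η) (by
    rw [norm_add_sq_real, hi, he2, ← hρ]; ring)
  have h2 := key (p - e) (-(2 * q) + η) (by
    rw [norm_sub_sq_real, hi, he2, ← hρ]; ring)
  have hR : (‖e‖ ^ 2 - ⟪p, e⟫ ^ 2 / ρ ^ 2) / ρ + 2 * ‖e‖ ^ 4 / ρ ^ 3
      = ρ * (η - q ^ 2 + 2 * η ^ 2) := by
    rw [show ‖e‖ ^ 4 = (‖e‖ ^ 2) ^ 2 by ring, hi, he2]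
    field_simp
  rw [hR]
  have h3 : η * (4 * η ^ 2 + 3 * 4 * 4 * q ^ 2) / 32 ≤ 2 * η ^ 2 + η ^ 2 / 4 := by
    nlinarith [mul_nonneg hη0 (sub_nonneg.mpr hqη), mul_nonneg (sq_nonneg η) (sub_nonneg.mpr hη1)]
  have h4 : (1 + (2 * q + η) / 2 - (2 * q + η) ^ 2 / 8 + (2 * q + η) ^ 3 / 16)
      + (1 + (-(2 * q) + η) / 2 - (-(2 * q) + η) ^ 2 / 8 + (-(2 * q) + η) ^ 3 / 16) - 2
      ≤ η - q ^ 2 + 2 * η ^ 2 := by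
    nlinarith
  have h5 := mul_le_mul_of_nonneg_left h4 hp.le
  linarith

variable {ι : Type*} [Fintype ι]

lemma sum_norm_second_difference_le (b : OrthonormalBasis ι ℝ E) {p : E} {h m : ℝ}
    (hm : 0 < m) (hp : m ≤ ‖p‖) (hh : 0 < h) (hhm : h ≤ m) :
    ∑ i, (‖p + h • b i‖ + ‖p - h • b i‖ - 2 * ‖p‖)
      ≤ h ^ 2 * (((Fintype.card ι : ℝ) - 1) / m + 2 * Fintype.card ι * h ^ 2 / m ^ 3) := by
  have hp0 : 0 < ‖p‖ := hm.trans_le hp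
  have hn (i : ι) : ‖h • b i‖ = h := by simp [norm_smul, abs_of_pos hh]
  have hcard : (1 : ℝ) ≤ Fintype.card ι := by
    have : Nonempty ι := by
      by_contra hι
      rw [not_nonempty_iff] at hι
      have h0 := b.sum_repr p
      simp only [Finset.univ_eq_empty, Finset.sum_empty] at h0
      simp [← h0] at hp0
    exact_mod_cast Fintype.card_pos
  calc _ ≤ ∑ i, ((h ^ 2 - h ^ 2 * ⟪p, b i⟫ ^ 2 / ‖p‖ ^ 2) / ‖p‖ + 2 * h ^ 4 / ‖p‖ ^ 3) := by
        refine Finset.sum_le_sum fun i _ ↦ ?_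
        have := norm_add_add_norm_sub_le (p := p) (e := h • b i) hp0
          (by rw [hn]; exact hhm.trans hp)
        rwa [hn, inner_smul_right, mul_pow] at this
    _ = h ^ 2 * (((Fintype.card ι : ℝ) - 1) / ‖p‖ + 2 * Fintype.card ι * h ^ 2 / ‖p‖ ^ 3) := by
        have hs : ∑ i, ⟪p, b i⟫ ^ 2 = ‖p‖ ^ 2 := by
          rw [← real_inner_self_eq_norm_sq, ← b.sum_inner_mul_inner p p]
          exact Finset.sum_congr rfl fun i _ ↦ by rw [real_inner_comm p (b i), sq]
        rw [Finset.sum_add_distrib, ← Finset.sum_div, Finset.sum_sub_distrib, ← Finset.sum_div,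
          ← Finset.mul_sum, hs]
        simp only [Finset.sum_const, Finset.card_univ, nsmul_eq_mul]
        field_simp
    _ ≤ _ := by
        have : 0 ≤ (Fintype.card ι : ℝ) - 1 := by linarith
        gcongr

variable [FiniteDimensional ℝ E] [MeasurableSpace E] [BorelSpace E]

lemma integral_mul_sub_translate {ψ f : E → ℝ} (hψ : Continuous ψ) (hψc : HasCompactSupport ψ)
    (hf : Continuous f) (v : E) :
    ∫ x, (ψ (x + v) - ψ x) * (f (x + v) - f x)
      = -∫ x, ψ x * (f (x + v) + f (x - v) - 2 * f x) := by
  have i1 : Integrable fun x ↦ ψ x * (f x - f (x - v)) :=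
    (by fun_prop : Continuous fun x ↦ ψ x * (f x - f (x - v))).integrable_of_hasCompactSupport
      hψc.mul_right
  have i2 : Integrable fun x ↦ ψ x * (f (x + v) - f x) :=
    (by fun_prop : Continuous fun x ↦ ψ x * (f (x + v) - f x)).integrable_of_hasCompactSupport
      hψc.mul_right
  have i3 := i1.comp_add_right v
  have e := integral_add_right_eq_self (μ := volume) (fun x ↦ ψ x * (f x - f (x - v))) v
  simp only [add_sub_cancel_right] at i3 e
  calc _ = ∫ x, (ψ (x + v) * (f (x + v) - f x) - ψ x * (f (x + v) - f x)) := by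
        congr 1; ext x; ring
    _ = _ := by
        rw [integral_sub i3 i2, e, ← integral_sub i1 i2, ← integral_neg]
        congr 1; ext x; ring

/-- A Lipschitz function whose discrete Laplacians are uniformly controlled on the support
of a test function has a distributional Laplacian with the limiting bound. -/
lemma abs_integral_inner_gradient_le (b : OrthonormalBasis ι ℝ E) {ψ f : E → ℝ} {C : NNReal}
    (hψ : ContDiff ℝ 1 ψ) (hψc : HasCompactSupport ψ) (hf : LipschitzWith C f) {A : ℝ → ℝ}
    {a : ℝ} (hA : Filter.Tendsto A (nhdsWithin 0 (Ioi 0)) (nhds a))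
    (hbound : ∀ᶠ h in nhdsWithin (0 : ℝ) (Ioi 0), ∀ x ∈ tsupport ψ,
      |∑ i, (f (x + h • b i) + f (x - h • b i) - 2 * f x)| ≤ h ^ 2 * A h) :
    |∫ x, ⟪gradient ψ x, gradient f x⟫| ≤ a * ∫ x, |ψ x| := by
  obtain ⟨D, hD⟩ := hψ.lipschitzWith_of_hasCompactSupport hψc one_ne_zero
  set F : ℝ → E → ℝ := fun h x ↦
    ∑ i, (h⁻¹ * (ψ (x + h • b i) - ψ x)) * (h⁻¹ * (f (x + h • b i) - f x)) with hF
  have hlim : Filter.Tendsto (fun h ↦ ∫ x, F h x) (nhdsWithin 0 (Ioi 0))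
      (nhds (∫ x, ⟪gradient ψ x, gradient f x⟫)) := by
    refine tendsto_integral_filter_of_dominated_convergence
      ((cthickening 1 (tsupport ψ)).indicator fun _ ↦ ∑ _i : ι, (D : ℝ) * C) ?_ ?_ ?_ ?_
    · refine Filter.Eventually.of_forall fun h ↦ Continuous.aestronglyMeasurable ?_
      have := hψ.continuous
      have := hf.continuous
      fun_prop
    · filter_upwards [Ioo_mem_nhdsGT (zero_lt_one' ℝ)] with h hh
      refine Filter.Eventually.of_forall fun x ↦ ?_
      have hn (i : ι) : ‖h • b i‖ = h := by simp [norm_smul, abs_of_pos hh.1]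
      have lip {K : NNReal} {g : E → ℝ} (hg : LipschitzWith K g) (i : ι) :
          |h⁻¹ * (g (x + h • b i) - g x)| ≤ K := by
        have := hg.dist_le_mul (x + h • b i) x
        rw [dist_self_add_left, hn, Real.dist_eq] at this
        rw [abs_mul, abs_inv, abs_of_pos hh.1, inv_mul_le_iff₀ hh.1]
        linarith
      by_cases hx : x ∈ cthickening 1 (tsupport ψ)
      · rw [indicator_of_mem hx]
        refine (norm_sum_le _ _).trans (Finset.sum_le_sum fun i _ ↦ ?_)
        rw [Real.norm_eq_abs, abs_mul]
        exact mul_le_mul (lip hD i) (lip hf i) (abs_nonneg _) D.2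
      · rw [indicator_of_notMem hx]
        have hx0 : ψ x = 0 := by
          by_contra h0
          exact hx (self_subset_cthickening _ (subset_tsupport _ h0))
        have hx1 (i : ι) : ψ (x + h • b i) = 0 := by
          by_contra h0
          refine hx (mem_cthickening_of_dist_le x _ 1 _ (subset_tsupport _ h0) ?_)
          rw [dist_self_add_right, hn]
          exact hh.2.le
        simp [hF, hx0, hx1]
    · rw [integrable_indicator_iff isClosed_cthickening.measurableSet]
      refine integrableOn_const ?_
      exact (hψc.isCompact.cthickening).measure_lt_top.ne
    · filter_upwards [hf.ae_differentiableAt (μ := volume)] with x hfx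
      have hψx : DifferentiableAt ℝ ψ x := hψ.differentiable one_ne_zero x
      have lim {g : E → ℝ} (hg : DifferentiableAt ℝ g x) (i : ι) :
          Filter.Tendsto (fun h : ℝ ↦ h⁻¹ * (g (x + h • b i) - g x)) (nhdsWithin 0 (Ioi 0))
            (nhds ⟪gradient g x, b i⟫) := by
        have h1 : HasLineDerivAt ℝ g ⟪gradient g x, b i⟫ x (b i) := by
          have := hg.hasGradientAt.hasFDerivAt.hasLineDerivAt (b i)
          simpa using this
        exact h1.tendsto_slope_zero_right
      rw [← b.sum_inner_mul_inner]
      refine tendsto_finsetSum _ fun i _ ↦ ?_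
      rw [real_inner_comm (gradient f x)]
      exact (lim hψx i).mul (lim hfx i)
  refine le_of_tendsto_of_tendsto hlim.abs (hA.mul_const _) ?_
  filter_upwards [hbound, self_mem_nhdsWithin] with h hb (hh : 0 < h)
  have hψ0 := hψ.continuous
  have hf0 := hf.continuous
  have hS : ∫ x, F h x
      = -∫ x, ψ x * ((h ^ 2)⁻¹ * ∑ i, (f (x + h • b i) + f (x - h • b i) - 2 * f x)) := by
    have e1 : F h = fun x ↦ (h ^ 2)⁻¹ *
        ∑ i, (ψ (x + h • b i) - ψ x) * (f (x + h • b i) - f x) := by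
      ext x
      rw [hF, Finset.mul_sum]
      exact Finset.sum_congr rfl fun i _ ↦ by rw [← inv_pow]; ring
    have e2 : (fun x ↦ ψ x * ((h ^ 2)⁻¹ *
        ∑ i, (f (x + h • b i) + f (x - h • b i) - 2 * f x))) = fun x ↦ (h ^ 2)⁻¹ *
        ∑ i, ψ x * (f (x + h • b i) + f (x - h • b i) - 2 * f x) := by
      ext x
      rw [← Finset.mul_sum]; ring
    rw [e1, e2, integral_const_mul, integral_const_mul, integral_finsetSum, integral_finsetSum,
      ← mul_neg, ← Finset.sum_neg_distrib]
    · congr 1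
      exact Finset.sum_congr rfl fun i _ ↦ integral_mul_sub_translate hψ0 hψc hf0 _
    · intro i _
      exact (by fun_prop : Continuous _).integrable_of_hasCompactSupport hψc.mul_right
    · intro i _
      refine Continuous.integrable_of_hasCompactSupport (by fun_prop) ?_
      exact ((hψc.comp_homeomorph (Homeomorph.addRight (h • b i))).sub hψc).mul_right
  rw [hS, abs_neg, ← integral_const_mul, ← Real.norm_eq_abs]
  refine norm_integral_le_of_norm_le
    ((hψ0.integrable_of_hasCompactSupport hψc).abs.const_mul _)
    (Filter.Eventually.of_forall fun x ↦ ?_)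
  by_cases hx : x ∈ tsupport ψ
  · rw [norm_mul, Real.norm_eq_abs, mul_comm]
    refine mul_le_mul_of_nonneg_right ?_ (abs_nonneg _)
    rw [Real.norm_eq_abs, abs_mul, abs_inv, abs_of_pos (by positivity : 0 < h ^ 2),
      inv_mul_le_iff₀ (by positivity)]
    exact hb x hx
  · simp [image_eq_zero_of_notMem_tsupport hx]

end SecondDifference

section Distance

variable {d : ℕ} {Ω : Set (EuclideanSpace ℝ (Fin d))}

lemma notMem_of_mem_frontier {X : Type*} [TopologicalSpace X] {s : Set X} (hs : IsOpen s) {y : X}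
    (hy : y ∈ frontier s) : y ∉ s := by
  rw [hs.frontier_eq] at hy
  exact hy.2

lemma dist_eq_of_exterior_ball (hΩ : IsOpen Ω) {u : ℝ} {y z : EuclideanSpace ℝ (Fin d)}
    (hy : y ∈ frontier Ω) (hz : closedBall z u ∩ closure Ω = {y}) : dist y z = u := by
  have hyz : y ∈ closedBall z u ∩ closure Ω := hz ▸ mem_singleton y
  refine le_antisymm hyz.1 (not_lt.mp fun hlt ↦ ?_)
  obtain ⟨w, hwB, hwΩ⟩ := mem_closure_iff.mp hyz.2 _ isOpen_ball (mem_ball.mpr hlt)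
  have hw : w ∈ ({y} : Set _) := hz ▸ ⟨ball_subset_closedBall hwB, subset_closure hwΩ⟩
  exact notMem_of_mem_frontier hΩ hy (hw ▸ hwΩ)

lemma dist_eq_of_interior_ball (hΩ : IsOpen Ω) {u : ℝ} (hu : 0 < u)
    {y z z' : EuclideanSpace ℝ (Fin d)} (hy : y ∈ frontier Ω)
    (hz : closedBall z u ∩ Ωᶜ = {y}) (hz' : closedBall z' u ∩ closure Ω = {y}) :
    dist y z = u := by
  have hyz : y ∈ closedBall z u ∩ Ωᶜ := hz ▸ mem_singleton y
  refine le_antisymm hyz.1 (not_lt.mp fun hlt ↦ ?_)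
  have hyz' := dist_eq_of_exterior_ball hΩ hy hz'
  rw [dist_eq_norm'] at hyz'
  set s := (u - dist y z) / u with hs
  have hsu : s * u = u - dist y z := by rw [hs]; field_simp
  have hs0 : 0 < s := div_pos (by linarith) hu
  have hs1 : s ≤ 1 := by
    rw [hs, div_le_one hu]
    linarith [dist_nonneg (x := y) (y := z)]
  set w := y + s • (z' - y) with hw
  have hwy : dist w y = u - dist y z := by
    rw [hw, dist_self_add_left, norm_smul, hyz', Real.norm_eq_abs, abs_of_pos hs0, hsu]
  have hwz' : w ∈ closedBall z' u := by
    have : w - z' = (s - 1) • (z' - y) := by rw [hw]; module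
    rw [mem_closedBall, dist_eq_norm, this, norm_smul, hyz', Real.norm_eq_abs,
      abs_of_nonpos (by linarith)]
    nlinarith
  have hne : w ≠ y := by
    rw [← dist_pos, hwy]; linarith
  have hwΩ : w ∉ closure Ω := fun hc ↦ hne (by
    have : w ∈ ({y} : Set _) := hz' ▸ ⟨hwz', hc⟩
    exact this)
  have : w ∈ ({y} : Set _) := by
    rw [← hz]
    refine ⟨?_, fun hc ↦ hwΩ (subset_closure hc)⟩
    rw [mem_closedBall]
    linarith [dist_triangle w y z]
  exact hne this

lemma sub_dist_le_distB (hΩ : IsOpen Ω) {u : ℝ} {y z : EuclideanSpace ℝ (Fin d)}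
    (hy : y ∈ frontier Ω) (hz : closedBall z u ∩ Ωᶜ = {y}) (hyz : dist y z = u)
    (w : EuclideanSpace ℝ (Fin d)) : u - dist w z ≤ distB Ω w := by
  refine (le_infDist ⟨y, hy⟩).mpr fun v hv ↦ ?_
  have huv : u ≤ dist v z := by
    by_contra! hlt
    have hvy : v ∈ ({y} : Set _) := hz ▸ ⟨hlt.le, notMem_of_mem_frontier hΩ hv⟩
    rw [mem_singleton_iff.mp hvy, hyz] at hlt
    exact lt_irrefl _ hlt
  linarith [dist_triangle_left v z w]

lemma distB_le_dist_sub (hΩ : IsOpen Ω) {u : ℝ} {y z : EuclideanSpace ℝ (Fin d)} (hzΩ : z ∉ closure Ω)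
    (hz : closedBall z u ∩ closure Ω = {y}) (hyz : dist y z = u)
    {w : EuclideanSpace ℝ (Fin d)} (hw : w ∈ Ω) : distB Ω w ≤ dist w z - u := by
  obtain ⟨v, hvs, hv⟩ : (segment ℝ w z ∩ frontier Ω).Nonempty := by
    by_contra hne
    have hcover : segment ℝ w z ⊆ Ω ∪ (closure Ω)ᶜ := fun v hv ↦ by
      by_contra hc
      rw [mem_union, mem_compl_iff, not_or, not_not] at hc
      exact hne ⟨v, hv, hΩ.frontier_eq ▸ ⟨hc.2, hc.1⟩⟩
    obtain ⟨v, -, hv, hv'⟩ := (convex_segment w z).isPreconnected Ω (closure Ω)ᶜ hΩ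
      isClosed_closure.isOpen_compl hcover ⟨w, left_mem_segment ℝ w z, hw⟩
      ⟨z, right_mem_segment ℝ w z, hzΩ⟩
    exact hv' (subset_closure hv)
  have huv : u ≤ dist v z := by
    by_contra! hlt
    have hvy : v ∈ ({y} : Set _) := hz ▸ ⟨hlt.le, frontier_subset_closure hv⟩
    rw [mem_singleton_iff.mp hvy, hyz] at hlt
    exact lt_irrefl _ hlt
  have h1 : distB Ω w ≤ dist w v := infDist_le_dist_of_mem hv
  linarith [dist_add_dist_of_mem_segment hvs]

lemma sub_eq_smul_sub_of_dist_eq {E : Type*} [NormedAddCommGroup E] [InnerProductSpace ℝ E]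
    {x y z : E} {t u : ℝ} (hu : 0 < u) (hxy : dist x y = t) (hyz : dist y z = u)
    (hxz : dist x z = t + u) : x - y = (t / u) • (y - z) := by
  rw [dist_eq_norm] at hxy hyz hxz
  have h : SameRay ℝ (x - y) (y - z) := by
    rw [sameRay_iff_norm_add, sub_add_sub_cancel, hxz, hxy, hyz]
  have := h.norm_smul_eq
  rw [hxy, hyz] at this
  rw [div_eq_inv_mul, mul_smul, this, inv_smul_smul₀ hu.ne']

/-- At a point whose nearest boundary point satisfies the two-sided ball condition, the distance
function is touched from above and from below by the signed distances to two spheres. -/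
lemma exists_touching_balls (hΩ : IsOpen Ω) {u : ℝ} (hu : 0 < u)
    {x y : EuclideanSpace ℝ (Fin d)} (hx : x ∈ Ω) (hy : y ∈ frontier Ω)
    (hball : TwoSidedBall Ω u y) (hxy : dist x y = distB Ω x) (hxu : distB Ω x ≤ u) :
    ∃ z z', dist x z = u - distB Ω x ∧ dist x z' = u + distB Ω x ∧
      (∀ w, u - dist w z ≤ distB Ω w) ∧ ∀ w ∈ Ω, distB Ω w ≤ dist w z' - u := by
  obtain ⟨⟨z, hzΩ, hz⟩, z', hzΩ', hz'⟩ := hball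
  have hyz' := dist_eq_of_exterior_ball hΩ hy hz'
  have hyz := dist_eq_of_interior_ball hΩ hu hy hz hz'
  have hlow := sub_dist_le_distB hΩ hy hz hyz
  have hupp : ∀ w ∈ Ω, distB Ω w ≤ dist w z' - u :=
    fun w ↦ distB_le_dist_sub hΩ hzΩ' hz' hyz'
  have hxz' : dist x z' = distB Ω x + u := by
    linarith [hupp x hx, dist_triangle x y z']
  have hzz' : dist z z' = u + u := by
    have h1 := hlow z
    rw [dist_self] at h1
    linarith [hupp z hzΩ, dist_triangle z y z', dist_comm y z]
  refine ⟨z, z', ?_, by linarith, hlow, hupp⟩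
  have e1 := sub_eq_smul_sub_of_dist_eq hu hxy hyz' hxz'
  have e2 := sub_eq_smul_sub_of_dist_eq hu (by rw [dist_comm, hyz]) hyz' hzz'
  have e3 : x - z = (distB Ω x / u - 1) • (y - z') := by
    rw [← sub_sub_sub_cancel_right x z y, e1, e2, div_self hu.ne']
    module
  have h1 : distB Ω x / u ≤ 1 := (div_le_one hu).mpr hxu
  rw [dist_eq_norm, e3, norm_smul, ← dist_eq_norm y z', hyz', Real.norm_eq_abs,
    abs_of_nonpos (by linarith)]
  field_simp
  ring

end Distance

/-- If the two-sided ball condition with radius `u` holds at every point of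
`Γ ∩ U` for a bounded open `U`, `0 < r < u/2`, and every point of `Γ_r ∩ U` has its
nearest boundary point in `Γ ∩ U`, then
`|∫_Ω ∇ψ · ∇d_Γ| ≤ 2(d-1) u⁻¹ ‖ψ‖₁` for all `ψ ∈ C_c^1(Γ_r ∩ U)`. -/
theorem stmt9 {d : ℕ} (hd : 1 ≤ d) (Ω : Set (EuclideanSpace ℝ (Fin d)))
    (hΩ : IsDomainSet Ω)
    (U : Set (EuclideanSpace ℝ (Fin d))) (hUo : IsOpen U) (hUb : Bornology.IsBounded U)
    (u : ℝ) (hu : 0 < u)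
    (hball : ∀ y ∈ frontier Ω ∩ U, TwoSidedBall Ω u y)
    (r : ℝ) (hr0 : 0 < r) (hru : r < u/2)
    (hnear : ∀ x ∈ bdryLayer Ω r ∩ U, ∃ y ∈ frontier Ω ∩ U, dist x y = distB Ω x)
    (ψ : EuclideanSpace ℝ (Fin d) → ℝ) (hψ : IsCc1 (bdryLayer Ω r ∩ U) ψ) :
    |(∫ x in Ω, ⟪gradient ψ x, gradient (distB Ω) x⟫)|
      ≤ 2 * ((d : ℝ) - 1) * u⁻¹ * ∫ x in Ω, |ψ x| := by
  obtain ⟨hψ1, hψc, hψs⟩ := hψ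
  obtain ⟨hΩo, -, -⟩ := hΩ
  have hsΩ : tsupport ψ ⊆ Ω := fun x hx ↦ (hψs hx).1.1
  have hψ0 {x} (hx : x ∉ Ω) : ψ x = 0 :=
    image_eq_zero_of_notMem_tsupport fun h ↦ hx (hsΩ h)
  have hgrad {x} (hx : x ∉ Ω) : gradient ψ x = 0 := by
    have : fderiv ℝ ψ x = 0 := by
      by_contra h0
      exact hx (hsΩ (support_fderiv_subset ℝ h0))
    simp [gradient, this]
  rw [setIntegral_eq_integral_of_forall_compl_eq_zero fun x hx ↦ by simp [hgrad hx],
    setIntegral_eq_integral_of_forall_compl_eq_zero fun x hx ↦ by simp [hψ0 hx]]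
  have hlip : LipschitzWith 1 (distB Ω) := lipschitz_infDist_pt _
  obtain ⟨δ, hδ, hδΩ⟩ := hψc.isCompact.exists_thickening_subset_open hΩo hsΩ
  refine abs_integral_inner_gradient_le (EuclideanSpace.basisFun (Fin d) ℝ) hψ1 hψc hlip
    (A := fun h ↦ ((d : ℝ) - 1) / (u / 2) + 2 * d * h ^ 2 / (u / 2) ^ 3) ?_ ?_
  · have hc : Continuous fun h : ℝ ↦ ((d : ℝ) - 1) / (u / 2) + 2 * d * h ^ 2 / (u / 2) ^ 3 := by
      fun_prop
    have := (hc.tendsto 0).mono_left (nhdsWithin_le_nhds (s := Ioi 0))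
    convert this using 2
    field_simp
    ring
  · filter_upwards [Ioo_mem_nhdsGT (lt_min hδ (half_pos hu))] with h hh x hx
    have hhδ : h < δ := hh.2.trans_le (min_le_left _ _)
    have hhu : h < u / 2 := hh.2.trans_le (min_le_right _ _)
    have hh0 : 0 < h := hh.1
    obtain ⟨y, ⟨hyΓ, hyU⟩, hxy⟩ := hnear x (hψs hx)
    have hxr : distB Ω x < r := (hψs hx).1.2
    have hx0 : 0 ≤ distB Ω x := infDist_nonneg
    obtain ⟨z, z', hxz, hxz', hlow, hupp⟩ := exists_touching_balls hΩo hu (hsΩ hx) hyΓ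
      (hball y ⟨hyΓ, hyU⟩) hxy (by linarith)
    set b := EuclideanSpace.basisFun (Fin d) ℝ
    have hmem (v : EuclideanSpace ℝ (Fin d)) (hv : ‖v‖ = h) : x + v ∈ Ω := by
      refine hδΩ (mem_thickening_iff.mpr ⟨x, hx, ?_⟩)
      rwa [dist_self_add_left, hv]
    have hn (i) : ‖h • b i‖ = h := by simp [norm_smul, abs_of_pos hh0]
    rw [dist_eq_norm] at hxz hxz'
    have bound := fun p hp ↦ sum_norm_second_difference_le b (p := p) (half_pos hu) hp hh0 hhu.le
    simp only [Fintype.card_fin] at bound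
    rw [abs_le]
    constructor
    · refine neg_le.mp (le_trans ?_ (bound (x - z) (by linarith)))
      rw [← Finset.sum_neg_distrib]
      refine Finset.sum_le_sum fun i _ ↦ ?_
      have h1 := hlow (x + h • b i)
      have h2 := hlow (x - h • b i)
      rw [dist_eq_norm, add_sub_right_comm] at h1
      rw [dist_eq_norm, sub_right_comm] at h2
      linarith
    · refine le_trans ?_ (bound (x - z') (by linarith))
      refine Finset.sum_le_sum fun i _ ↦ ?_
      have h1 := hupp (x + h • b i) (hmem _ (hn i))
      have h2 := hupp (x - h • b i) (by
        rw [sub_eq_add_neg]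
        exact hmem _ (by rw [norm_neg, hn]))
      rw [dist_eq_norm, add_sub_right_comm] at h1
      rw [dist_eq_norm, sub_right_comm] at h2
      linarith
end
end
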